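/- arXiv:1908.06390 — 3 statements merged into one kernel-verified Lean document; each statement's English description precedes it below -/
import Mathlib

section
/- Let P be a set of n points in general position in the plane, n even. If R is a set of points disjoint from P such that every line through two points of P contains a point of R, then |R| ≥ n − 1. -/
abbrev Pt := Fin 2 → ℝ

def GenPos (S : Set Pt) : Prop :=
  ∀ x ∈ S, ∀ y ∈ S, ∀ z ∈ S, x ≠ y → x ≠ z → y ≠ z → ¬ Collinear ℝ ({x, y, z} : Set Pt)

theorem stmt1 (n : ℕ) (heven : Even n) (P R : Finset Pt)
    (hPcard : P.card = n) (hgp : GenPos ↑P) (hdisj : Disjoint P R)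
    (hpierce : ∀ x ∈ P, ∀ y ∈ P, x ≠ y → ∃ r ∈ R, Collinear ℝ ({x, y, r} : Set Pt)) :
    n - 1 ≤ R.card := by
  classical
  rcases P.eq_empty_or_nonempty with h | ⟨x, hx⟩
  · subst h
    simp at hPcard
    omega
  rw [← hPcard, ← Finset.card_erase_of_mem hx]
  have key : ∀ y, ∃ r, y ∈ P.erase x → r ∈ R ∧ Collinear ℝ ({x, y, r} : Set Pt) := by
    intro y
    by_cases hy : y ∈ P.erase x
    · obtain ⟨r, hr, hc⟩ := hpierce x hx y (Finset.mem_of_mem_erase hy)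
        (Finset.ne_of_mem_erase hy).symm
      exact ⟨r, fun _ => ⟨hr, hc⟩⟩
    · exact ⟨x, fun h => absurd h hy⟩
  choose f hf using key
  refine Finset.card_le_card_of_injOn f (fun y hy => (hf y hy).1) ?_
  intro y hy z hz hyz
  by_contra hne
  have hy' : y ∈ P.erase x := hy
  have hz' : z ∈ P.erase x := hz
  obtain ⟨hr, hcy⟩ := hf y hy'
  obtain ⟨-, hcz⟩ := hf z hz'
  have hyz' : f y = f z := hyz
  rw [← hyz'] at hcz
  have hxr : x ≠ f y := by
    intro h
    rw [← h] at hr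
    exact Finset.disjoint_left.mp hdisj hx hr
  have m1 : y ∈ line[ℝ, x, f y] :=
    hcy.mem_affineSpan_of_mem_of_ne (by simp) (by simp) (by simp) hxr
  have m2 : z ∈ line[ℝ, x, f y] :=
    hcz.mem_affineSpan_of_mem_of_ne (by simp) (by simp) (by simp) hxr
  exact hgp x hx y (Finset.mem_of_mem_erase hy') z (Finset.mem_of_mem_erase hz')
    (Finset.ne_of_mem_erase hy').symm (Finset.ne_of_mem_erase hz').symm hne
    (collinear_triple_of_mem_affineSpan_pair (left_mem_affineSpan_pair ℝ _ _) m1 m2)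
end

section
/- Let P be a set of n points in convex position, labeled x_0, …, x_{n−1} in cyclic order, and R a set of n points disjoint from P, all outside conv(P), such that every line through two points of P contains exactly one point of R lying outside the corresponding segment, and for every p ∈ P exactly one point of R is not 'relevant' for p and the line through them supports conv(P) at p alone. Then R can be labeled r_0, …, r_{n−1} so that x_i, x_j, r_k are collinear if and only if i + j + k ≡ 0 (mod n). -/
/-- Signed area determinant of three points (positive iff counterclockwise). -/
def det3 (a b c : Pt) : ℝ :=
  (b 0 - a 0) * (c 1 - a 1) - (b 1 - a 1) * (c 0 - a 0)

/-! Combinatorial part -/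

def SInv {n : ℕ} {α : Type} (ρ : ZMod n → ZMod n → α) (r : α) (a : ZMod n) (l : ℕ) : Prop :=
  ∀ k < l, ∃ m < l, ρ (a + (k : ℕ)) (a + (m : ℕ)) = r

lemma zcast_inj {n : ℕ} (a : ZMod n) {k l : ℕ} (hk : k < n) (hl : l < n)
    (h : a + (k : ZMod n) = a + (l : ZMod n)) : k = l := by
  have h1 : (k : ZMod n) = l := add_left_cancel h
  rw [ZMod.natCast_eq_natCast_iff] at h1
  exact Nat.ModEq.eq_of_lt_of_lt h1 hk hl

section comb
variable {n : ℕ} {α : Type} {ρ : ZMod n → ZMod n → α}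

lemma sinv_full (hn : 0 < n) (hsurj : ∀ i, Function.Surjective (ρ i)) (r : α) (a : ZMod n) :
    SInv ρ r a n := by
  intro k hk
  haveI : NeZero n := ⟨hn.ne'⟩
  obtain ⟨j, hj⟩ := hsurj (a + (k : ℕ)) r
  refine ⟨(j - a).val, ZMod.val_lt _, ?_⟩
  rw [ZMod.natCast_zmod_val]
  simpa using hj

lemma sinv_split (hsymm : ∀ i j, ρ i j = ρ j i) (hinj : ∀ i, Function.Injective (ρ i))
    {r : α} {a : ZMod n} {l s : ℕ} (hl : l ≤ n) (hs : s ≤ l)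
    (h1 : SInv ρ r a l) (h2 : SInv ρ r a s) : SInv ρ r (a + (s : ℕ)) (l - s) := by
  intro k hk
  obtain ⟨m, hm, hkm⟩ := h1 (s + k) (by omega)
  have hms : s ≤ m := by
    by_contra hlt
    push Not at hlt
    obtain ⟨m', hm', h'⟩ := h2 m hlt
    rw [hsymm] at hkm
    have := zcast_inj a (by omega) (by omega) (hinj _ (hkm.trans h'.symm))
    omega
  refine ⟨m - s, by omega, ?_⟩
  rw [add_assoc, add_assoc, ← Nat.cast_add, ← Nat.cast_add]
  rw [show s + (m - s) = m by omega]
  exact hkm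

lemma sinv_chord (hsymm : ∀ i j, ρ i j = ρ j i) (hinj : ∀ i, Function.Injective (ρ i))
    (hnc : ∀ (i : ZMod n) (a b c : ℕ), 0 < a → a < b → b < c → c < n →
      ρ i (i + (b : ℕ)) ≠ ρ (i + (a : ℕ)) (i + (c : ℕ)))
    {r : α} {a : ZMod n} {l m : ℕ} (hl : l ≤ n) (hm : m < l)
    (h1 : SInv ρ r a l) (h2 : ρ a (a + (m : ℕ)) = r) : SInv ρ r a (m + 1) := by
  intro k hk
  rcases Nat.eq_zero_or_pos k with rfl | hk0
  · exact ⟨m, by omega, by simpa using h2⟩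
  rcases Nat.lt_or_ge k m with hkm | hkm
  · obtain ⟨c, hc, hkc⟩ := h1 k (by omega)
    refine ⟨c, ?_, hkc⟩
    by_contra hcm
    exact hnc a k m c hk0 hkm (by omega) (by omega) (h2.trans hkc.symm)
  · have : k = m := by omega
    subst this
    exact ⟨0, by omega, by rw [hsymm]; simpa using h2⟩

lemma sinv_inner (hsymm : ∀ i j, ρ i j = ρ j i) (hinj : ∀ i, Function.Injective (ρ i))
    {r : α} {a : ZMod n} {m : ℕ} (hm : m < n)
    (h1 : SInv ρ r a (m + 1)) (h2 : ρ a (a + (m : ℕ)) = r) :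
    SInv ρ r (a + (1 : ℕ)) (m - 1) := by
  intro k hk
  obtain ⟨c, hc, hkc⟩ := h1 (1 + k) (by omega)
  have hc0 : c ≠ 0 := by
    rintro rfl
    rw [hsymm] at hkc
    have h3 : ρ (a + (0 : ℕ)) (a + (m : ℕ)) = r := by simpa using h2
    have := zcast_inj a (by omega) (by omega) (hinj _ (hkc.trans h3.symm))
    omega
  have hcm : c ≠ m := by
    rintro rfl
    rw [hsymm] at hkc
    have h3 : ρ (a + (c : ℕ)) (a + (0 : ℕ)) = r := by rw [hsymm]; simpa using h2
    have := zcast_inj a (by omega) (by omega) (hinj _ (hkc.trans h3.symm))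
    omega
  refine ⟨c - 1, by omega, ?_⟩
  rw [add_assoc, add_assoc, ← Nat.cast_add, ← Nat.cast_add, show 1 + (c - 1) = c by omega]
  exact hkc

lemma ear (hsymm : ∀ i j, ρ i j = ρ j i) (hinj : ∀ i, Function.Injective (ρ i))
    (hnc : ∀ (i : ZMod n) (a b c : ℕ), 0 < a → a < b → b < c → c < n →
      ρ i (i + (b : ℕ)) ≠ ρ (i + (a : ℕ)) (i + (c : ℕ)))
    (r : α) : ∀ (l : ℕ) (a : ZMod n), 0 < l → l ≤ n → SInv ρ r a l →
      ∃ (k : ℕ) (e : Fin 2), k + e.val < l ∧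
        ρ (a + (k : ℕ)) (a + (k : ℕ) + (e.val : ℕ)) = r := by
  intro l
  induction l using Nat.strong_induction_on with
  | _ l ih =>
    intro a hl0 hl h
    obtain ⟨m, hm, h0⟩ := h 0 hl0
    have h0' : ρ a (a + (m : ℕ)) = r := by simpa using h0
    have h3 := sinv_chord hsymm hinj hnc hl hm h h0'
    rcases Nat.lt_or_ge m 2 with h2 | h2
    · exact ⟨0, ⟨m, h2⟩, by simpa using hm, by simpa using h0'⟩
    · obtain ⟨k, e, hk, he⟩ := ih (m - 1) (by omega) (a + (1 : ℕ)) (by omega) (by omega)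
        (sinv_inner hsymm hinj (by omega) h3 h0')
      refine ⟨1 + k, e, by omega, ?_⟩
      rw [Nat.cast_add, ← add_assoc]
      exact he

theorem comb (hn : 0 < n) [Fintype α] [DecidableEq α] (hcard : Fintype.card α = n)
    (hsymm : ∀ i j, ρ i j = ρ j i) (hinj : ∀ i, Function.Injective (ρ i))
    (hnc : ∀ (i : ZMod n) (a b c : ℕ), 0 < a → a < b → b < c → c < n →
      ρ i (i + (b : ℕ)) ≠ ρ (i + (a : ℕ)) (i + (c : ℕ))) (i j : ZMod n) :
    ρ (i + 1) (j - 1) = ρ i j := by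
  haveI : NeZero n := ⟨hn.ne'⟩
  have hsurj : ∀ i, Function.Surjective (ρ i) := fun i =>
    ((Fintype.bijective_iff_injective_and_card (ρ i)).2
      ⟨hinj i, by rw [hcard, ZMod.card]⟩).2
  let g : ZMod n × Fin 2 → α := fun p => ρ p.1 (p.1 + (p.2.val : ℕ))
  let fib : α → Finset (ZMod n × Fin 2) := fun r => Finset.univ.filter (fun p => g p = r)
  have hsum : ∑ r : α, (fib r).card = 2 * n := by
    have := Finset.card_eq_sum_card_fiberwise (f := g) (s := Finset.univ) (t := Finset.univ)
      (by intro p _; simp)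
    rw [← this]
    simp [ZMod.card, mul_comm]
  have hge : ∀ r : α, 2 ≤ (fib r).card := by
    intro r
    suffices ∃ p q : ZMod n × Fin 2, p ≠ q ∧ g p = r ∧ g q = r by
      obtain ⟨p, q, hpq, hp, hq⟩ := this
      have : ({p, q} : Finset (ZMod n × Fin 2)) ⊆ fib r := by
        intro z hz
        simp only [Finset.mem_insert, Finset.mem_singleton] at hz
        rcases hz with rfl | rfl <;> simp [fib, hp, hq]
      have h := Finset.card_le_card this
      rwa [Finset.card_pair hpq] at h
    have hfull := sinv_full hn hsurj r (0 : ZMod n)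
    obtain ⟨m, hm, h0⟩ := hfull 0 hn
    have h0' : ρ (0 : ZMod n) ((0 : ZMod n) + (m : ℕ)) = r := by simpa using h0
    have h3 := sinv_chord hsymm hinj hnc le_rfl hm hfull h0'
    obtain ⟨k, e, hk, he⟩ := ear hsymm hinj hnc r (m + 1) 0 (by omega) (by omega) h3
    rcases Nat.lt_or_ge (m + 1) n with h4 | h4
    · have h5 := sinv_split hsymm hinj le_rfl h4.le hfull h3
      obtain ⟨k', e', hk', he'⟩ := ear hsymm hinj hnc r _ _ (by omega) (by omega) h5
      refine ⟨(0 + (k : ℕ), e), (0 + ((m + 1 : ℕ) : ZMod n) + (k' : ℕ), e'), ?_, he, he'⟩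
      intro heq
      have h6 := congrArg Prod.fst heq
      simp only at h6
      rw [add_assoc, ← Nat.cast_add] at h6
      have := zcast_inj _ (by omega) (by omega) h6
      omega
    · have hmn : m + 1 = n := by omega
      refine ⟨(0 + (k : ℕ), e), (0 + (m : ℕ), 1), ?_, he, ?_⟩
      · intro heq
        have h6 := congrArg Prod.fst heq
        have h7 := congrArg Prod.snd heq
        simp only at h6 h7
        have := zcast_inj _ (by omega) (by omega) h6
        subst h7
        simp at hk
        omega
      · show ρ _ _ = r
        rw [hsymm]
        have : ((0 : ZMod n) + (m : ℕ) + (((1 : Fin 2).val : ℕ) : ZMod n)) = 0 := by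
          have : ((m + 1 : ℕ) : ZMod n) = 0 := by rw [hmn]; simp
          simpa using this
        rw [this]
        exact h0'
  have hle : ∀ r : α, (fib r).card ≤ 2 := by
    intro r
    by_contra hlt
    have : ∑ r : α, 2 < ∑ r : α, (fib r).card :=
      Finset.sum_lt_sum (fun r _ => hge r) ⟨r, Finset.mem_univ _, by omega⟩
    rw [hsum] at this
    simp [hcard] at this
    omega
  -- now the main argument
  obtain ⟨b, hb1, hbn, hbj⟩ : ∃ b : ℕ, 1 ≤ b ∧ b ≤ n ∧ j = i + (b : ℕ) := by
    rcases Nat.eq_zero_or_pos (j - i).val with h | h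
    · refine ⟨n, hn, le_rfl, ?_⟩
      rw [ZMod.val_eq_zero] at h
      simpa using sub_eq_zero.1 h
    · refine ⟨(j - i).val, h, (ZMod.val_lt _).le, ?_⟩
      simp
  obtain ⟨r, hr⟩ : ∃ r, r = ρ i j := ⟨_, rfl⟩
  rw [← hr]
  have hij : i = j + ((n - b : ℕ) : ZMod n) := by
    rw [hbj, add_assoc, ← Nat.cast_add, show b + (n - b) = n by omega]; simp
  have hfull := sinv_full hn hsurj r j
  have hA := sinv_chord (m := n - b) hsymm hinj hnc le_rfl (by omega) hfull
    (by rw [← hij, hsymm]; exact hr.symm)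
  have hB := sinv_split hsymm hinj le_rfl (by omega) hfull hA
  have hji : j + ((n - b + 1 : ℕ) : ZMod n) = i + (1 : ℕ) := by
    rw [Nat.cast_add, ← add_assoc, ← hij]
  rw [hji, show n - (n - b + 1) = b - 1 by omega] at hB
  rcases Nat.eq_or_lt_of_le hb1 with rfl | hb2
  · rw [hsymm, hr]
    subst hbj
    simp
  obtain ⟨m, hm, hm1⟩ := hB 0 (by omega)
  have hm' : ρ (i + (1 : ℕ)) (i + (1 : ℕ) + (m : ℕ)) = r := by simpa using hm1
  have hC := sinv_chord hsymm hinj hnc (by omega) hm hB hm'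
  rcases Nat.eq_or_lt_of_le (show m + 1 ≤ b - 1 by omega) with hmb | hmb
  · rw [← hm', hbj, show b = 1 + m + 1 by omega]
    push_cast
    congr 1
    ring
  exfalso
  have hD := sinv_split hsymm hinj (by omega) hmb.le hB hC
  obtain ⟨k1, e1, hk1, he1⟩ := ear hsymm hinj hnc r _ _ (by omega) (by omega) hA
  obtain ⟨k2, e2, hk2, he2⟩ := ear hsymm hinj hnc r _ _ (by omega) (by omega) hC
  obtain ⟨k3, e3, hk3, he3⟩ := ear hsymm hinj hnc r _ _ (by omega) (by omega) hD
  have e2' : i + ((1 : ℕ) : ZMod n) + (k2 : ZMod n) = j + ((n - b + 1 + k2 : ℕ) : ZMod n) := by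
    rw [← hji, Nat.cast_add (n - b + 1), add_assoc]
  have e3' : i + ((1 : ℕ) : ZMod n) + ((m + 1 : ℕ) : ZMod n) + (k3 : ZMod n)
      = j + ((n - b + 1 + (m + 1) + k3 : ℕ) : ZMod n) := by
    rw [← hji, Nat.cast_add (n - b + 1 + (m + 1)), Nat.cast_add (n - b + 1)]
    ring
  rw [e2'] at he2
  rw [e3'] at he3
  have hsub : ({(j + ((k1 : ℕ) : ZMod n), e1), (j + ((n - b + 1 + k2 : ℕ) : ZMod n), e2),
      (j + ((n - b + 1 + (m + 1) + k3 : ℕ) : ZMod n), e3)} : Finset (ZMod n × Fin 2)) ⊆ fib r := by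
    intro z hz
    simp only [Finset.mem_insert, Finset.mem_singleton] at hz
    simp only [fib, Finset.mem_filter, Finset.mem_univ, true_and]
    rcases hz with rfl | rfl | rfl
    · exact he1
    · exact he2
    · exact he3
  have h3 := (Finset.card_le_card hsub).trans (hle r)
  rw [Finset.card_eq_three.2 ⟨_, _, _, ?_, ?_, ?_, rfl⟩] at h3
  · omega
  all_goals
    intro heq
    have h6 := zcast_inj _ (by omega) (by omega) (congrArg Prod.fst heq)
    omega

end comb

/-! Geometric part -/

lemma det3_of_collinear {a b c : Pt} (h : Collinear ℝ ({a, b, c} : Set Pt)) :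
    det3 a b c = 0 := by
  rw [collinear_iff_of_mem (p₀ := a) (by simp)] at h
  obtain ⟨v, hv⟩ := h
  obtain ⟨t, rfl⟩ := hv b (by simp)
  obtain ⟨s, rfl⟩ := hv c (by simp)
  simp [det3]
  ring

lemma not_cross {p q u v r : Pt} (hpu : Collinear ℝ ({p, u, r} : Set Pt))
    (hqv : Collinear ℝ ({q, v, r} : Set Pt)) (hr : r ∉ segment ℝ p u)
    (h1 : 0 < det3 q v p) (h2 : 0 < det3 q u v) : False := by
  have h3 := det3_of_collinear hqv
  have hpu' : p ≠ u := by
    rintro rfl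
    simp only [det3] at h1 h2
    linarith
  rw [collinear_iff_of_mem (p₀ := p) (by simp)] at hpu
  obtain ⟨w, hw⟩ := hpu
  obtain ⟨t, ht⟩ := hw u (by simp)
  obtain ⟨s, hs⟩ := hw r (by simp)
  have ht0 : t ≠ 0 := by
    rintro rfl
    apply hpu'
    simp [ht]
  have hrs : r = (1 - s / t) • p + (s / t) • u := by
    rw [hs, ht]
    ext k
    simp
    field_simp
    ring
  have h4 : (1 - s / t) * det3 q v p - (s / t) * det3 q u v = 0 := by
    rw [← h3, hrs]
    simp [det3]
    ring
  generalize s / t = z at hrs h4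
  have hz0 : 0 ≤ z := by
    by_contra hz
    push Not at hz
    nlinarith
  have hz1 : 0 ≤ 1 - z := by
    by_contra hz
    push Not at hz
    nlinarith
  exact hr ⟨1 - z, z, hz1, hz0, by ring, hrs.symm⟩

lemma det_pos {n : ℕ} (x : ZMod n → Pt)
    (hconv : ∀ i j : ZMod n, j ≠ i → j ≠ i + 1 → 0 < det3 (x i) (x (i + 1)) (x j))
    (i : ZMod n) (a : ℕ) (ha : 0 < a) : ∀ b : ℕ, a < b → b < n →
      0 < det3 (x i) (x (i + (a : ℕ))) (x (i + (b : ℕ))) := by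
  have hne : ∀ k l : ℕ, k < n → l < n → k ≠ l → i + (k : ZMod n) ≠ i + (l : ZMod n) :=
    fun k l hk hl hkl h => hkl (zcast_inj i hk hl h)
  have hbase : ∀ k : ℕ, 1 < k → k < n → 0 < det3 (x i) (x (i + 1)) (x (i + (k : ℕ))) := by
    intro k hk hkn
    apply hconv
    · simpa using hne k 0 hkn (by omega) (by omega)
    · simpa using hne k 1 hkn (by omega) (by omega)
  have hadj : ∀ k : ℕ, 0 < k → k + 1 < n →
      0 < det3 (x i) (x (i + (k : ℕ))) (x (i + ((k + 1 : ℕ) : ZMod n))) := by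
    intro k hk hkn
    have h := hconv (i + (k : ℕ)) i (by simpa using hne 0 k (by omega) (by omega) (by omega))
      (by have := hne 0 (k + 1) (by omega) (by omega) (by omega)
          push_cast at this
          rw [add_assoc]
          simpa using this)
    rw [Nat.cast_add, ← add_assoc, Nat.cast_one]
    simp only [det3] at h ⊢
    linarith
  intro b hab
  induction b, hab using Nat.le_induction with
  | base => intro hb; exact hadj a ha hb
  | succ b hab ih =>
    intro hb
    have h1 := ih (by omega)
    have h2 := hadj b (by omega) hb
    rcases Nat.eq_or_lt_of_le (show 1 ≤ a from ha) with rfl | ha1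
    · simpa using hbase (b + 1) (by omega) hb
    have h3 := hbase a ha1 (by omega)
    have h4 := hbase b (by omega) (by omega)
    have h5 := hbase (b + 1) (by omega) hb
    generalize x (i + ((b + 1 : ℕ) : ZMod n)) = B' at *
    generalize x (i + (b : ZMod n)) = B at *
    generalize x (i + (a : ZMod n)) = A at *
    generalize x (i + 1) = O at *
    have key : det3 (x i) O B * det3 (x i) A B' =
        det3 (x i) O A * det3 (x i) B B' + det3 (x i) O B' * det3 (x i) A B := by
      simp only [det3]; ring
    have : 0 < det3 (x i) O B * det3 (x i) A B' := by rw [key]; positivity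
    exact (pos_iff_pos_of_mul_pos this).1 h4

theorem stmt6 (n : ℕ) (hn : 3 ≤ n) (x : ZMod n → Pt) (hxinj : Function.Injective x)
    -- x_0, …, x_{n-1} are in convex position in counterclockwise cyclic order:
    (hconv : ∀ i j : ZMod n, j ≠ i → j ≠ i + 1 → 0 < det3 (x i) (x (i + 1)) (x j))
    (R : Finset Pt) (hRcard : R.card = n)
    (hdisj : ∀ i, x i ∉ R)
    (hout : ∀ r ∈ R, r ∉ convexHull ℝ (Set.range x))
    -- every line through two points of P contains exactly one point of R
    -- lying outside the corresponding segment: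
    (huniq : ∀ i j : ZMod n, i ≠ j → ∃! r : Pt, r ∈ R ∧
      Collinear ℝ ({x i, x j, r} : Set Pt) ∧ r ∉ segment ℝ (x i) (x j))
    -- for every p ∈ P exactly one point of R is not relevant for p, and the line
    -- through them supports conv(P) at p alone:
    (hsupp : ∀ i : ZMod n, ∃! r : Pt, r ∈ R ∧
      (¬ ∃ j : ZMod n, j ≠ i ∧ Collinear ℝ ({x i, x j, r} : Set Pt)
          ∧ r ∉ segment ℝ (x i) (x j)) ∧
      (∀ q ∈ convexHull ℝ (Set.range x), Collinear ℝ ({x i, r, q} : Set Pt) → q = x i)) :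
    ∃ r : ZMod n → Pt, Function.Injective r ∧ Set.range r = ↑R ∧
      ∀ i j k : ZMod n, i ≠ j →
        (Collinear ℝ ({x i, x j, r k} : Set Pt) ↔ i + j + k = 0) := by
  classical
  have hn0 : 0 < n := by omega
  haveI : NeZero n := ⟨hn0.ne'⟩
  have hpos := det_pos x hconv
  have hseg : ∀ i j, ∀ r ∈ R, r ∉ segment ℝ (x i) (x j) := fun i j r hr h =>
    hout r hr (segment_subset_convexHull (Set.mem_range_self i) (Set.mem_range_self j) h)
  have hform : ∀ i j : ZMod n, i ≠ j → ∃ b : ℕ, 0 < b ∧ b < n ∧ j = i + (b : ℕ) := by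
    intro i j hij
    refine ⟨(j - i).val, ?_, ZMod.val_lt _, by simp⟩
    rw [Nat.pos_iff_ne_zero, Ne, ZMod.val_eq_zero, sub_eq_zero]
    exact fun h => hij h.symm
  have hdet : ∀ i j k : ZMod n, i ≠ j → i ≠ k → j ≠ k → det3 (x i) (x j) (x k) ≠ 0 := by
    intro i j k hij hik hjk
    obtain ⟨a, ha0, han, rfl⟩ := hform i j hij
    obtain ⟨b, hb0, hbn, rfl⟩ := hform i k hik
    rcases lt_trichotomy a b with h | h | h
    · exact (hpos i a ha0 b h hbn).ne'
    · exact absurd (by rw [h]) hjk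
    · have := hpos i b hb0 a h han
      intro h0
      simp only [det3] at this h0
      linarith
  have hex : ∀ i j : ZMod n, ∃ r : R, i ≠ j → Collinear ℝ ({x i, x j, (r : Pt)} : Set Pt) ∧
      ∀ s ∈ R, Collinear ℝ ({x i, x j, s} : Set Pt) → s = r := by
    intro i j
    by_cases hij : i = j
    · obtain ⟨r, hr⟩ : R.Nonempty := Finset.card_pos.1 (by omega)
      exact ⟨⟨r, hr⟩, fun h => absurd hij h⟩
    · obtain ⟨r, ⟨hr, hc, _⟩, hu⟩ := huniq i j hij
      exact ⟨⟨r, hr⟩, fun _ => ⟨hc, fun s hs hsc => hu s ⟨hs, hsc, hseg i j s hs⟩⟩⟩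
  choose ρ0 hρ0 using hex
  have hinj0 : ∀ i j k, i ≠ j → i ≠ k → ρ0 i j = ρ0 i k → j = k := by
    intro i j k hij hik h
    by_contra hjk
    have h1 := det3_of_collinear (hρ0 i j hij).1
    have h2 := det3_of_collinear (hρ0 i k hik).1
    rw [← h] at h2
    have hne : x i ≠ (ρ0 i j : Pt) := fun h => hdisj i (h ▸ (ρ0 i j).2)
    generalize (ρ0 i j : Pt) = r at *
    have h3 := hdet i j k hij hik hjk
    apply hne
    have e0 : (r 0 - x i 0) * det3 (x i) (x j) (x k) = 0 := by
      have : (r 0 - x i 0) * det3 (x i) (x j) (x k) =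
        (x j 0 - x i 0) * -det3 (x i) (x k) r + (x k 0 - x i 0) * det3 (x i) (x j) r := by
        simp only [det3]; ring
      rw [this, h1, h2]; ring
    have e1 : (r 1 - x i 1) * det3 (x i) (x j) (x k) = 0 := by
      have : (r 1 - x i 1) * det3 (x i) (x j) (x k) =
        (x j 1 - x i 1) * -det3 (x i) (x k) r + (x k 1 - x i 1) * det3 (x i) (x j) r := by
        simp only [det3]; ring
      rw [this, h1, h2]; ring
    have f0 := (mul_eq_zero.1 e0).resolve_right h3
    have f1 := (mul_eq_zero.1 e1).resolve_right h3
    ext k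
    fin_cases k
    · simp; linarith
    · simp; linarith
  have hmiss : ∀ i : ZMod n, ∃ r : R, ∀ j, j ≠ i → ρ0 i j ≠ r := by
    intro i
    by_contra hcon
    push Not at hcon
    have hsub : (Finset.univ : Finset R) ⊆ (Finset.univ.erase i).image (ρ0 i) := by
      intro r _
      obtain ⟨j, hj, hjr⟩ := hcon r
      exact Finset.mem_image.2 ⟨j, by simp [hj], hjr⟩
    have h1 := (Finset.card_le_card hsub).trans Finset.card_image_le
    rw [Finset.card_erase_of_mem (Finset.mem_univ _), Finset.card_univ, Finset.card_univ,
      ZMod.card, Fintype.card_coe] at h1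
    omega
  choose t ht using hmiss
  let ρ : ZMod n → ZMod n → R := fun i j => if i = j then t i else ρ0 i j
  have hρne : ∀ i j, i ≠ j → ρ i j = ρ0 i j := fun i j h => if_neg h
  have hρeq : ∀ i, ρ i i = t i := fun i => if_pos rfl
  have hcol : ∀ i j, i ≠ j → ∀ s : R, Collinear ℝ ({x i, x j, (s : Pt)} : Set Pt) ↔ s = ρ i j := by
    intro i j hij s
    rw [hρne i j hij]
    refine ⟨fun h => Subtype.ext ((hρ0 i j hij).2 s s.2 h), ?_⟩
    rintro rfl
    exact (hρ0 i j hij).1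
  have hsymm : ∀ i j, ρ i j = ρ j i := by
    intro i j
    by_cases hij : i = j
    · rw [hij]
    · rw [← hcol j i (Ne.symm hij), Set.insert_comm, hcol i j hij]
  have hinj : ∀ i, Function.Injective (ρ i) := by
    intro i j k h
    by_cases hij : i = j
    · subst hij
      by_cases hik : i = k
      · exact hik
      · rw [hρeq, hρne i k hik] at h
        exact absurd h.symm (ht i k (Ne.symm hik))
    · by_cases hik : i = k
      · subst hik
        rw [hρeq, hρne i j hij] at h
        exact absurd h (ht i j (Ne.symm hij))
      · rw [hρne i j hij, hρne i k hik] at h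
        exact hinj0 i j k hij hik h
  have hnc : ∀ (i : ZMod n) (a b c : ℕ), 0 < a → a < b → b < c → c < n →
      ρ i (i + (b : ℕ)) ≠ ρ (i + (a : ℕ)) (i + (c : ℕ)) := by
    intro i a b c ha hab hbc hcn h
    have n1 : i ≠ i + (b : ℕ) := by
      intro h
      have := zcast_inj (k := 0) (l := b) i (by omega) (by omega) (by simpa using h)
      omega
    have n2 : i + (a : ℕ) ≠ i + (c : ℕ) := by
      intro h
      have := zcast_inj i (by omega) (by omega) h
      omega
    have c1 := (hcol _ _ n1 _).2 rfl
    have c2 := (hcol _ _ n2 _).2 h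
    refine not_cross c1 c2 (hseg _ _ _ (ρ i (i + (b : ℕ))).2) ?_ ?_
    · have := hpos i a ha c (by omega) hcn
      simp only [det3] at this ⊢
      linarith
    · have := hpos (i + (a : ℕ)) (b - a) (by omega) (c - a) (by omega) (by omega)
      rw [add_assoc, add_assoc, ← Nat.cast_add, ← Nat.cast_add,
        show a + (b - a) = b by omega, show a + (c - a) = c by omega] at this
      exact this
  have hstep := comb hn0 (by rw [Fintype.card_coe, hRcard]) hsymm hinj hnc
  have hsum : ∀ (m : ℕ) (i : ZMod n) , ∀ j, ρ (i + (m : ℕ)) (j - (m : ℕ)) = ρ i j := by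
    intro m
    induction m with
    | zero => intro i j; simp
    | succ m ih =>
      intro i j
      rw [← ih i j, ← hstep (i + (m : ℕ)) (j - (m : ℕ))]
      push_cast
      congr 1 <;> ring
  have hsum' : ∀ i j, ρ i j = ρ 0 (i + j) := by
    intro i j
    have := hsum i.val 0 (i + j)
    rw [ZMod.natCast_zmod_val] at this
    rw [← this]
    congr 1 <;> ring
  have hinjr : Function.Injective (fun k : ZMod n => ((ρ 0 (-k) : R) : Pt)) := by
    intro k l h
    exact neg_injective (hinj 0 (Subtype.ext h))
  refine ⟨fun k => (ρ 0 (-k) : R), hinjr, ?_, ?_⟩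
  · have hs : Function.Surjective (ρ 0) :=
      ((Fintype.bijective_iff_injective_and_card (ρ 0)).2
        ⟨hinj 0, by rw [Fintype.card_coe, hRcard, ZMod.card]⟩).2
    ext p
    constructor
    · rintro ⟨k, rfl⟩
      exact (ρ 0 (-k)).2
    · intro hp
      obtain ⟨k, hk⟩ := hs ⟨p, hp⟩
      exact ⟨-k, by simp [hk]⟩
  · intro i j k hij
    show Collinear ℝ ({x i, x j, ((ρ 0 (-k) : R) : Pt)} : Set Pt) ↔ _
    rw [hcol i j hij, hsum' i j, (hinj 0).eq_iff]
    constructor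
    · intro h; rw [← h]; ring
    · intro h; exact (eq_neg_of_add_eq_zero_left h).symm
end

section
/- Let P be a set of n points in general position in the plane and R a set of n points disjoint from P such that for every x, y ∈ P there is a point r ∈ R on the line through x and y lying outside the segment [x, y]. Then P ∪ R is contained in a cubic curve (the zero set of a nonzero polynomial of degree at most 3). -/
/-- Orientation determinant of three points. -/
def ori (a b c : Pt) : ℝ := (b 0 - a 0) * (c 1 - a 1) - (b 1 - a 1) * (c 0 - a 0)

/-- Value of the cubic polynomial with the given ten coefficients. -/
def cubv (c : Fin 10 → ℝ) (x y : ℝ) : ℝ :=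
  c 0 + c 1 * x + c 2 * y + c 3 * x ^ 2 + c 4 * (x * y) + c 5 * y ^ 2 + c 6 * x ^ 3
    + c 7 * (x ^ 2 * y) + c 8 * (x * y ^ 2) + c 9 * y ^ 3

def quadv (c : Fin 6 → ℝ) (x y : ℝ) : ℝ :=
  c 0 + c 1 * x + c 2 * y + c 3 * x ^ 2 + c 4 * (x * y) + c 5 * y ^ 2

theorem pt_ext {a b : Pt} (h0 : a 0 = b 0) (h1 : a 1 = b 1) : a = b := by
  funext i; fin_cases i <;> assumption

/-- A univariate cubic with four distinct roots is zero. -/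
theorem uni3 (a b c d x1 x2 x3 x4 : ℝ) (h12 : x1 ≠ x2) (h13 : x1 ≠ x3) (h14 : x1 ≠ x4)
    (h23 : x2 ≠ x3) (h24 : x2 ≠ x4) (h34 : x3 ≠ x4)
    (e1 : a + b * x1 + c * x1 ^ 2 + d * x1 ^ 3 = 0) (e2 : a + b * x2 + c * x2 ^ 2 + d * x2 ^ 3 = 0)
    (e3 : a + b * x3 + c * x3 ^ 2 + d * x3 ^ 3 = 0) (e4 : a + b * x4 + c * x4 ^ 2 + d * x4 ^ 3 = 0) :
    a = 0 ∧ b = 0 ∧ c = 0 ∧ d = 0 := by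
  have f2 : b + c * (x1 + x2) + d * (x1 ^ 2 + x1 * x2 + x2 ^ 2) = 0 := by
    apply mul_left_cancel₀ (sub_ne_zero.2 h12); linear_combination e1 - e2
  have f3 : b + c * (x1 + x3) + d * (x1 ^ 2 + x1 * x3 + x3 ^ 2) = 0 := by
    apply mul_left_cancel₀ (sub_ne_zero.2 h13); linear_combination e1 - e3
  have f4 : b + c * (x1 + x4) + d * (x1 ^ 2 + x1 * x4 + x4 ^ 2) = 0 := by
    apply mul_left_cancel₀ (sub_ne_zero.2 h14); linear_combination e1 - e4
  have g3 : c + d * (x1 + x2 + x3) = 0 := by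
    apply mul_left_cancel₀ (sub_ne_zero.2 h23); linear_combination f2 - f3
  have g4 : c + d * (x1 + x2 + x4) = 0 := by
    apply mul_left_cancel₀ (sub_ne_zero.2 h24); linear_combination f2 - f4
  have hd : d = 0 := by
    apply mul_left_cancel₀ (sub_ne_zero.2 h34); linear_combination g3 - g4
  subst hd
  have hc : c = 0 := by linarith
  subst hc
  have hb : b = 0 := by linarith
  subst hb
  refine ⟨by linarith, rfl, rfl, rfl⟩

theorem uni2 (a b c x1 x2 x3 : ℝ) (h12 : x1 ≠ x2) (h13 : x1 ≠ x3) (h23 : x2 ≠ x3)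
    (e1 : a + b * x1 + c * x1 ^ 2 = 0) (e2 : a + b * x2 + c * x2 ^ 2 = 0)
    (e3 : a + b * x3 + c * x3 ^ 2 = 0) :
    a = 0 ∧ b = 0 ∧ c = 0 := by
  have f2 : b + c * (x1 + x2) = 0 := by
    apply mul_left_cancel₀ (sub_ne_zero.2 h12); linear_combination e1 - e2
  have f3 : b + c * (x1 + x3) = 0 := by
    apply mul_left_cancel₀ (sub_ne_zero.2 h13); linear_combination e1 - e3
  have hd : c = 0 := by
    apply mul_left_cancel₀ (sub_ne_zero.2 h23); linear_combination f2 - f3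
  subst hd
  have hb : b = 0 := by linarith
  subst hb
  refine ⟨by linarith, rfl, rfl⟩

theorem fac3_slope (c : Fin 10 → ℝ) (m k x1 x2 x3 x4 : ℝ) (h12 : x1 ≠ x2) (h13 : x1 ≠ x3)
    (h14 : x1 ≠ x4) (h23 : x2 ≠ x3) (h24 : x2 ≠ x4) (h34 : x3 ≠ x4)
    (e1 : cubv c x1 (m * x1 + k) = 0) (e2 : cubv c x2 (m * x2 + k) = 0)
    (e3 : cubv c x3 (m * x3 + k) = 0) (e4 : cubv c x4 (m * x4 + k) = 0) :
    ∃ q : Fin 6 → ℝ, ∀ x y, cubv c x y = (y - m * x - k) * quadv q x y := by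
  have key : ∀ x, cubv c x (m * x + k) =
      (c 0 + c 2 * k + c 5 * k ^ 2 + c 9 * k ^ 3)
      + (c 1 + c 2 * m + c 4 * k + 2 * c 5 * m * k + c 8 * k ^ 2 + 3 * c 9 * m * k ^ 2) * x
      + (c 3 + c 4 * m + c 5 * m ^ 2 + c 7 * k + 2 * c 8 * m * k + 3 * c 9 * m ^ 2 * k) * x ^ 2
      + (c 6 + c 7 * m + c 8 * m ^ 2 + c 9 * m ^ 3) * x ^ 3 := by
    intro x; unfold cubv; ring
  rw [key] at e1 e2 e3 e4
  obtain ⟨z0, z1, z2, z3⟩ := uni3 _ _ _ _ x1 x2 x3 x4 h12 h13 h14 h23 h24 h34 e1 e2 e3 e4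
  refine ⟨![c 2 + c 5 * k + c 9 * k ^ 2, c 4 + c 5 * m + c 8 * k + 2 * c 9 * m * k,
    c 5 + c 9 * k, c 7 + c 8 * m + c 9 * m ^ 2, c 8 + c 9 * m, c 9], ?_⟩
  intro x y
  have h0 : cubv c x (m * x + k) = 0 := by rw [key, z0, z1, z2, z3]; ring
  rw [← sub_zero (cubv c x y), ← h0]
  simp [cubv, quadv, Matrix.cons_val_zero, Matrix.cons_val_one]
  ring

theorem fac2_slope (c : Fin 6 → ℝ) (m k x1 x2 x3 : ℝ) (h12 : x1 ≠ x2) (h13 : x1 ≠ x3)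
    (h23 : x2 ≠ x3)
    (e1 : quadv c x1 (m * x1 + k) = 0) (e2 : quadv c x2 (m * x2 + k) = 0)
    (e3 : quadv c x3 (m * x3 + k) = 0) :
    ∃ q0 q1 q2 : ℝ, ∀ x y, quadv c x y = (y - m * x - k) * (q0 + q1 * x + q2 * y) := by
  have key : ∀ x, quadv c x (m * x + k) =
      (c 0 + c 2 * k + c 5 * k ^ 2)
      + (c 1 + c 2 * m + c 4 * k + 2 * c 5 * m * k) * x
      + (c 3 + c 4 * m + c 5 * m ^ 2) * x ^ 2 := by
    intro x; unfold quadv; ring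
  rw [key] at e1 e2 e3
  obtain ⟨z0, z1, z2⟩ := uni2 _ _ _ x1 x2 x3 h12 h13 h23 e1 e2 e3
  refine ⟨c 2 + c 5 * k, c 4 + c 5 * m, c 5, ?_⟩
  intro x y
  have h0 : quadv c x (m * x + k) = 0 := by rw [key, z0, z1, z2]; ring
  rw [← sub_zero (quadv c x y), ← h0]
  simp only [quadv]
  ring

theorem cub_swap (c : Fin 10 → ℝ) (x y : ℝ) :
    cubv ![c 0, c 2, c 1, c 5, c 4, c 3, c 9, c 8, c 7, c 6] x y = cubv c y x := by
  simp [cubv]; ring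

theorem quad_swap (c : Fin 6 → ℝ) (x y : ℝ) :
    quadv ![c 0, c 2, c 1, c 5, c 4, c 3] x y = quadv c y x := by
  simp [quadv]; ring

/-- A cubic vanishing at four distinct points of a line is divisible by the line. -/
theorem fac3 (c : Fin 10 → ℝ) (A B C : ℝ) (hAB : A ≠ 0 ∨ B ≠ 0) (p1 p2 p3 p4 : Pt)
    (l1 : A * p1 0 + B * p1 1 + C = 0) (l2 : A * p2 0 + B * p2 1 + C = 0)
    (l3 : A * p3 0 + B * p3 1 + C = 0) (l4 : A * p4 0 + B * p4 1 + C = 0)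
    (h12 : p1 ≠ p2) (h13 : p1 ≠ p3) (h14 : p1 ≠ p4)
    (h23 : p2 ≠ p3) (h24 : p2 ≠ p4) (h34 : p3 ≠ p4)
    (e1 : cubv c (p1 0) (p1 1) = 0) (e2 : cubv c (p2 0) (p2 1) = 0)
    (e3 : cubv c (p3 0) (p3 1) = 0) (e4 : cubv c (p4 0) (p4 1) = 0) :
    ∃ q : Fin 6 → ℝ, ∀ x y, cubv c x y = (A * x + B * y + C) * quadv q x y := by
  by_cases hB : B = 0
  · subst hB
    have hA : A ≠ 0 := by simpa using hAB
    have hx : ∀ p : Pt, A * p 0 + 0 * p 1 + C = 0 → p 0 = 0 * p 1 + (-C / A) := by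
      intro p hp; field_simp; linarith
    have hn : ∀ p q : Pt, A * p 0 + 0 * p 1 + C = 0 → A * q 0 + 0 * q 1 + C = 0 → p ≠ q →
        p 1 ≠ q 1 := by
      intro p q hp hq hpq h
      exact hpq (pt_ext (by rw [hx p hp, hx q hq]; simp) h)
    have e : ∀ p : Pt, A * p 0 + 0 * p 1 + C = 0 → cubv c (p 0) (p 1) = 0 →
        cubv ![c 0, c 2, c 1, c 5, c 4, c 3, c 9, c 8, c 7, c 6] (p 1) (0 * p 1 + (-C / A)) = 0 := by
      intro p hp h
      rw [← hx p hp, cub_swap, h]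
    obtain ⟨q, hq⟩ := fac3_slope _ 0 (-C / A) _ _ _ _ (hn _ _ l1 l2 h12) (hn _ _ l1 l3 h13)
      (hn _ _ l1 l4 h14) (hn _ _ l2 l3 h23) (hn _ _ l2 l4 h24) (hn _ _ l3 l4 h34)
      (e _ l1 e1) (e _ l2 e2) (e _ l3 e3) (e _ l4 e4)
    refine ⟨fun i => ![q 0, q 2, q 1, q 5, q 4, q 3] i / A, fun x y => ?_⟩
    have := hq y x
    rw [cub_swap] at this
    rw [this]
    simp [quadv]
    field_simp
    ring
  · have hy : ∀ p : Pt, A * p 0 + B * p 1 + C = 0 → p 1 = (-A / B) * p 0 + (-C / B) := by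
      intro p hp; field_simp; linarith
    have hn : ∀ p q : Pt, A * p 0 + B * p 1 + C = 0 → A * q 0 + B * q 1 + C = 0 → p ≠ q →
        p 0 ≠ q 0 := by
      intro p q hp hq hpq h
      exact hpq (pt_ext h (by rw [hy p hp, hy q hq, h]))
    have e : ∀ p : Pt, A * p 0 + B * p 1 + C = 0 → cubv c (p 0) (p 1) = 0 →
        cubv c (p 0) ((-A / B) * p 0 + (-C / B)) = 0 := by
      intro p hp h
      rw [← hy p hp, h]
    obtain ⟨q, hq⟩ := fac3_slope _ (-A / B) (-C / B) _ _ _ _ (hn _ _ l1 l2 h12) (hn _ _ l1 l3 h13)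
      (hn _ _ l1 l4 h14) (hn _ _ l2 l3 h23) (hn _ _ l2 l4 h24) (hn _ _ l3 l4 h34)
      (e _ l1 e1) (e _ l2 e2) (e _ l3 e3) (e _ l4 e4)
    refine ⟨fun i => q i / B, fun x y => ?_⟩
    rw [hq x y]
    simp [quadv]
    field_simp
    ring

theorem fac2 (c : Fin 6 → ℝ) (A B C : ℝ) (hAB : A ≠ 0 ∨ B ≠ 0) (p1 p2 p3 : Pt)
    (l1 : A * p1 0 + B * p1 1 + C = 0) (l2 : A * p2 0 + B * p2 1 + C = 0)
    (l3 : A * p3 0 + B * p3 1 + C = 0)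
    (h12 : p1 ≠ p2) (h13 : p1 ≠ p3) (h23 : p2 ≠ p3)
    (e1 : quadv c (p1 0) (p1 1) = 0) (e2 : quadv c (p2 0) (p2 1) = 0)
    (e3 : quadv c (p3 0) (p3 1) = 0) :
    ∃ q0 q1 q2 : ℝ, ∀ x y, quadv c x y = (A * x + B * y + C) * (q0 + q1 * x + q2 * y) := by
  by_cases hB : B = 0
  · subst hB
    have hA : A ≠ 0 := by simpa using hAB
    have hx : ∀ p : Pt, A * p 0 + 0 * p 1 + C = 0 → p 0 = 0 * p 1 + (-C / A) := by
      intro p hp; field_simp; linarith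
    have hn : ∀ p q : Pt, A * p 0 + 0 * p 1 + C = 0 → A * q 0 + 0 * q 1 + C = 0 → p ≠ q →
        p 1 ≠ q 1 := by
      intro p q hp hq hpq h
      exact hpq (pt_ext (by rw [hx p hp, hx q hq]; simp) h)
    have e : ∀ p : Pt, A * p 0 + 0 * p 1 + C = 0 → quadv c (p 0) (p 1) = 0 →
        quadv ![c 0, c 2, c 1, c 5, c 4, c 3] (p 1) (0 * p 1 + (-C / A)) = 0 := by
      intro p hp h
      rw [← hx p hp, quad_swap, h]
    obtain ⟨q0, q1, q2, hq⟩ := fac2_slope _ 0 (-C / A) _ _ _ (hn _ _ l1 l2 h12)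
      (hn _ _ l1 l3 h13) (hn _ _ l2 l3 h23) (e _ l1 e1) (e _ l2 e2) (e _ l3 e3)
    refine ⟨q0 / A, q2 / A, q1 / A, fun x y => ?_⟩
    have := hq y x
    rw [quad_swap] at this
    rw [this]
    field_simp
    ring
  · have hy : ∀ p : Pt, A * p 0 + B * p 1 + C = 0 → p 1 = (-A / B) * p 0 + (-C / B) := by
      intro p hp; field_simp; linarith
    have hn : ∀ p q : Pt, A * p 0 + B * p 1 + C = 0 → A * q 0 + B * q 1 + C = 0 → p ≠ q →
        p 0 ≠ q 0 := by
      intro p q hp hq hpq h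
      exact hpq (pt_ext h (by rw [hy p hp, hy q hq, h]))
    have e : ∀ p : Pt, A * p 0 + B * p 1 + C = 0 → quadv c (p 0) (p 1) = 0 →
        quadv c (p 0) ((-A / B) * p 0 + (-C / B)) = 0 := by
      intro p hp h
      rw [← hy p hp, h]
    obtain ⟨q0, q1, q2, hq⟩ := fac2_slope _ (-A / B) (-C / B) _ _ _ (hn _ _ l1 l2 h12)
      (hn _ _ l1 l3 h13) (hn _ _ l2 l3 h23) (e _ l1 e1) (e _ l2 e2) (e _ l3 e3)
    refine ⟨q0 / B, q1 / B, q2 / B, fun x y => ?_⟩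
    rw [hq x y]
    field_simp
    ring

/-- Points of a line are given by a parameter. -/
theorem param {a b c : Pt} (hab : a ≠ b) (h : ori a b c = 0) :
    ∃ t : ℝ, ∀ i, c i = a i + t * (b i - a i) := by
  by_cases h0 : b 0 - a 0 = 0
  · have h1 : b 1 - a 1 ≠ 0 := fun h1 => hab (pt_ext (by linarith) (by linarith))
    refine ⟨(c 1 - a 1) / (b 1 - a 1), fun i => ?_⟩
    have hc : c 0 - a 0 = 0 := by
      apply mul_left_cancel₀ h1
      unfold ori at h; rw [h0] at h; linarith
    fin_cases i
    · simp only [Fin.zero_eta, h0]; linarith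
    · simp; field_simp; ring
  · refine ⟨(c 0 - a 0) / (b 0 - a 0), fun i => ?_⟩
    unfold ori at h
    fin_cases i
    · simp; field_simp; ring
    · simp; field_simp; linarith

/-- The theorem of Chasles for a `3 × 3` grid of lines. -/
theorem grid (c : Fin 10 → ℝ) (p11 p12 p13 p21 p22 p23 p31 p32 p33 : Pt)
    (r1 : ori p11 p12 p13 = 0) (r2 : ori p21 p22 p23 = 0) (r3 : ori p31 p32 p33 = 0)
    (c3 : ori p13 p23 p33 = 0)
    (d12 : p11 ≠ p12) (d13 : p11 ≠ p13) (d23 : p12 ≠ p13)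
    (k1 : ori p11 p12 p21 ≠ 0) (k2 : ori p11 p12 p22 ≠ 0) (k3 : ori p11 p12 p23 ≠ 0)
    (m2 : ori p12 p22 p11 ≠ 0) (m3 : ori p13 p23 p11 ≠ 0)
    (dd12 : p21 ≠ p22) (dd13 : p21 ≠ p23) (dd23 : p22 ≠ p23)
    (q1 : ori p11 p12 p31 ≠ 0) (q2 : ori p11 p12 p32 ≠ 0)
    (q3 : ori p21 p22 p31 ≠ 0) (q4 : ori p21 p22 p32 ≠ 0) (ddd12 : p31 ≠ p32)
    (e11 : cubv c (p11 0) (p11 1) = 0) (e12 : cubv c (p12 0) (p12 1) = 0)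
    (e13 : cubv c (p13 0) (p13 1) = 0) (e21 : cubv c (p21 0) (p21 1) = 0)
    (e22 : cubv c (p22 0) (p22 1) = 0) (e23 : cubv c (p23 0) (p23 1) = 0)
    (e31 : cubv c (p31 0) (p31 1) = 0) (e32 : cubv c (p32 0) (p32 1) = 0)
    (f1 : ori p11 p21 p31 = 0) (f2 : ori p12 p22 p32 = 0) :
    cubv c (p33 0) (p33 1) = 0 := by
  obtain ⟨t, ht⟩ := param d12 r1
  have ht0 : t ≠ 0 := by
    rintro rfl; exact d13 (pt_ext (by rw [ht]; ring) (by rw [ht]; ring))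
  have ht1 : t ≠ 1 := by
    rintro rfl; exact d23 (pt_ext (by rw [ht]; ring) (by rw [ht]; ring))
  obtain ⟨s, hs⟩ : ∃ s : ℝ, s = |t| + 2 := ⟨_, rfl⟩
  have hst : s ≠ t := by have := le_abs_self t; intro h; linarith
  have hs0 : s ≠ 0 := by have := abs_nonneg t; intro h; linarith
  have hs1 : s ≠ 1 := by have := abs_nonneg t; intro h; linarith
  set w : Pt := fun i => p11 i + s * (p12 i - p11 i) with hw
  -- a nonzero coordinate difference
  have hdne : ∀ u v : ℝ, u ≠ v → (fun i => p11 i + u * (p12 i - p11 i) : Pt) ≠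
      fun i => p11 i + v * (p12 i - p11 i) := by
    intro u v huv h
    apply d12
    have : ∀ i, p12 i - p11 i = 0 := by
      intro i
      have : p11 i + u * (p12 i - p11 i) = p11 i + v * (p12 i - p11 i) := congrFun h i
      apply mul_left_cancel₀ (sub_ne_zero.2 huv)
      linarith
    exact pt_ext (by linarith [this 0]) (by linarith [this 1])
  have w1 : p11 ≠ w := by
    have := hdne 0 s hs0.symm
    simpa using this
  have w2 : p12 ≠ w := by
    have := hdne 1 s hs1.symm
    simpa using this
  have w3 : p13 ≠ w := by
    have := hdne t s hst.symm
    have h : p13 = (fun i => p11 i + t * (p12 i - p11 i)) := funext ht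
    rw [h]; exact this
  -- the product of the column lines
  have hprod : ∀ l : ℝ, ∃ c' : Fin 10 → ℝ, ∀ z : Pt, cubv c' (z 0) (z 1) =
      cubv c (z 0) (z 1) - l * (ori p11 p21 z * ori p12 p22 z * ori p13 p23 z) := by
    intro l
    have hl : ∀ a b : Pt, ∃ A B C : ℝ, ∀ z : Pt, ori a b z = A * z 0 + B * z 1 + C := by
      intro a b
      refine ⟨-(b 1 - a 1), b 0 - a 0, -(b 0 - a 0) * a 1 + (b 1 - a 1) * a 0, fun z => ?_⟩
      unfold ori; ring
    obtain ⟨A1, B1, C1, h1⟩ := hl p11 p21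
    obtain ⟨A2, B2, C2, h2⟩ := hl p12 p22
    obtain ⟨A3, B3, C3, h3⟩ := hl p13 p23
    refine ⟨![c 0 - l * (C1 * C2 * C3),
      c 1 - l * (A1 * C2 * C3 + C1 * A2 * C3 + C1 * C2 * A3),
      c 2 - l * (B1 * C2 * C3 + C1 * B2 * C3 + C1 * C2 * B3),
      c 3 - l * (A1 * A2 * C3 + A1 * C2 * A3 + C1 * A2 * A3),
      c 4 - l * (A1 * B2 * C3 + A1 * C2 * B3 + C1 * A2 * B3 + B1 * A2 * C3 + B1 * C2 * A3
        + C1 * B2 * A3),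
      c 5 - l * (B1 * B2 * C3 + B1 * C2 * B3 + C1 * B2 * B3),
      c 6 - l * (A1 * A2 * A3),
      c 7 - l * (A1 * A2 * B3 + A1 * B2 * A3 + B1 * A2 * A3),
      c 8 - l * (A1 * B2 * B3 + B1 * A2 * B3 + B1 * B2 * A3),
      c 9 - l * (B1 * B2 * B3)], fun z => ?_⟩
    rw [h1, h2, h3]
    simp [cubv]
    ring
  have hG : ori p11 p21 w * ori p12 p22 w * ori p13 p23 w ≠ 0 := by
    have g1 : ori p11 p21 w = - s * ori p11 p12 p21 := by simp only [ori, hw]; ring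
    have g2 : ori p12 p22 w = (1 - s) * ori p12 p22 p11 := by simp only [ori, hw]; ring
    have g3 : t * ori p13 p23 w = (t - s) * ori p13 p23 p11 := by
      simp only [ori, hw, ht]; ring
    refine mul_ne_zero (mul_ne_zero ?_ ?_) ?_
    · rw [g1]; exact mul_ne_zero (neg_ne_zero.2 hs0) k1
    · rw [g2]; exact mul_ne_zero (sub_ne_zero.2 hs1.symm) m2
    · intro h
      rw [h, mul_zero] at g3
      exact mul_ne_zero (sub_ne_zero.2 hst.symm) m3 g3.symm
  obtain ⟨c', hc'⟩ := hprod (cubv c (w 0) (w 1) / (ori p11 p21 w * ori p12 p22 w * ori p13 p23 w))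
  set l := (cubv c (w 0) (w 1) / (ori p11 p21 w * ori p12 p22 w * ori p13 p23 w)) with hl
  have oself1 : ∀ a b : Pt, ori a b a = 0 := by intro a b; unfold ori; ring
  have oself2 : ∀ a b : Pt, ori a b b = 0 := by intro a b; unfold ori; ring
  have v11 : cubv c' (p11 0) (p11 1) = 0 := by rw [hc', e11, oself1]; ring
  have v12 : cubv c' (p12 0) (p12 1) = 0 := by rw [hc', e12, oself1 p12]; ring
  have v13 : cubv c' (p13 0) (p13 1) = 0 := by rw [hc', e13, oself1 p13]; ring
  have vw : cubv c' (w 0) (w 1) = 0 := by rw [hc', hl, div_mul_cancel₀ _ hG, sub_self]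
  have v21 : cubv c' (p21 0) (p21 1) = 0 := by rw [hc', e21, oself2 p11]; ring
  have v22 : cubv c' (p22 0) (p22 1) = 0 := by rw [hc', e22, oself2 p12]; ring
  have v23 : cubv c' (p23 0) (p23 1) = 0 := by rw [hc', e23, oself2 p13]; ring
  have v31 : cubv c' (p31 0) (p31 1) = 0 := by rw [hc', e31, f1]; ring
  have v32 : cubv c' (p32 0) (p32 1) = 0 := by rw [hc', e32, f2]; ring
  have hline : ∀ a b z : Pt, -(b 1 - a 1) * z 0 + (b 0 - a 0) * z 1 +
      (-(b 0 - a 0) * a 1 + (b 1 - a 1) * a 0) = ori a b z := by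
    intro a b z; unfold ori; ring
  have hAB : ∀ a b : Pt, a ≠ b → -(b 1 - a 1) ≠ 0 ∨ b 0 - a 0 ≠ 0 := by
    intro a b hab
    by_contra hcon
    push Not at hcon
    exact hab (pt_ext (by linarith [hcon.2]) (by linarith [hcon.1]))
  have ow : ori p11 p12 w = 0 := by simp only [ori, hw]; ring
  obtain ⟨q, hq⟩ := fac3 c' _ _ _ (hAB _ _ d12) p11 p12 p13 w
    (by rw [hline, oself1]) (by rw [hline, oself2]) (by rw [hline, r1]) (by rw [hline, ow])
    d12 d13 w1 d23 w2 w3 v11 v12 v13 vw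
  have hq' : ∀ z : Pt, cubv c' (z 0) (z 1) = ori p11 p12 z * quadv q (z 0) (z 1) := by
    intro z; rw [hq, hline]
  have u : ∀ z : Pt, ori p11 p12 z ≠ 0 → cubv c' (z 0) (z 1) = 0 → quadv q (z 0) (z 1) = 0 := by
    intro z h1 h2
    rw [hq'] at h2
    exact (mul_eq_zero.1 h2).resolve_left h1
  obtain ⟨b0, b1, b2, hb⟩ := fac2 q _ _ _ (hAB _ _ dd12) p21 p22 p23
    (by rw [hline, oself1]) (by rw [hline, oself2]) (by rw [hline, r2])
    dd12 dd13 dd23 (u _ k1 v21) (u _ k2 v22) (u _ k3 v23)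
  have hb' : ∀ z : Pt, quadv q (z 0) (z 1) = ori p21 p22 z * (b0 + b1 * z 0 + b2 * z 1) := by
    intro z; rw [hb, hline]
  have u2 : ∀ z : Pt, ori p11 p12 z ≠ 0 → ori p21 p22 z ≠ 0 → cubv c' (z 0) (z 1) = 0 →
      (b0 + b1 * z 0 + b2 * z 1) = 0 := by
    intro z h1 h2 h3
    have := u z h1 h3
    rw [hb'] at this
    exact (mul_eq_zero.1 this).resolve_left h2
  have x1 := u2 _ q1 q3 v31
  have x2 := u2 _ q2 q4 v32
  obtain ⟨τ, hτ⟩ := param ddd12 r3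
  have x3 : (b0 + b1 * p33 0 + b2 * p33 1) = 0 := by
    rw [hτ, hτ]; linear_combination (1 - τ) * x1 + τ * x2
  have y1 : cubv c' (p33 0) (p33 1) = 0 := by
    rw [hq', hb', x3]; ring
  rw [hc', c3] at y1
  linarith


def IsCub (g : Pt → ℝ) : Prop := ∃ c : Fin 10 → ℝ, ∀ z : Pt, cubv c (z 0) (z 1) = g z

theorem isCub_add {g h : Pt → ℝ} (hg : IsCub g) (hh : IsCub h) : IsCub (fun z => g z + h z) := by
  obtain ⟨c, hc⟩ := hg
  obtain ⟨d, hd⟩ := hh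
  refine ⟨fun i => c i + d i, fun z => ?_⟩
  simp only [← hc, ← hd]; simp only [cubv]; ring

theorem isCub_prod (k : ℝ) (a b a' b' a'' b'' : Pt) :
    IsCub (fun z => k * (ori a b z * ori a' b' z * ori a'' b'' z)) := by
  have hl : ∀ a b : Pt, ∃ A B C : ℝ, ∀ z : Pt, ori a b z = A * z 0 + B * z 1 + C := by
    intro a b
    refine ⟨-(b 1 - a 1), b 0 - a 0, -(b 0 - a 0) * a 1 + (b 1 - a 1) * a 0, fun z => ?_⟩
    unfold ori; ring
  obtain ⟨A1, B1, C1, h1⟩ := hl a b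
  obtain ⟨A2, B2, C2, h2⟩ := hl a' b'
  obtain ⟨A3, B3, C3, h3⟩ := hl a'' b''
  refine ⟨![k * (C1 * C2 * C3),
    k * (A1 * C2 * C3 + C1 * A2 * C3 + C1 * C2 * A3),
    k * (B1 * C2 * C3 + C1 * B2 * C3 + C1 * C2 * B3),
    k * (A1 * A2 * C3 + A1 * C2 * A3 + C1 * A2 * A3),
    k * (A1 * B2 * C3 + A1 * C2 * B3 + C1 * A2 * B3 + B1 * A2 * C3 + B1 * C2 * A3
      + C1 * B2 * A3),
    k * (B1 * B2 * C3 + B1 * C2 * B3 + C1 * B2 * B3),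
    k * (A1 * A2 * A3),
    k * (A1 * A2 * B3 + A1 * B2 * A3 + B1 * A2 * A3),
    k * (A1 * B2 * B3 + B1 * A2 * B3 + B1 * B2 * A3),
    k * (B1 * B2 * B3)], fun z => ?_⟩
  simp only [h1, h2, h3]
  simp [cubv]
  ring

/-- The explicit cubic form through a pentagon, in barycentric coordinates. -/
def pentF (o p q m s t z0 z1 z2 : ℝ) : ℝ :=
  (-(s * q * (p * t - q * s) * o * t)) * (z1 * z0 * z0)
  + (s * q * (p * t - q * s) * p * m) * (z2 * z0 * z0)
  + (o * t * q * m * (p * t - q * s)) * (z0 * z1 * z1)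
  + (o * t * q * m * (o * s - p * m)) * (z2 * z1 * z1)
  + (m * p * (o * s - p * m) * s * q) * (z0 * z2 * z2)
  + (-(m * p * (o * s - p * m) * t * o)) * (z1 * z2 * z2)
  + (o * s * t * o * (p * t - q * s) - o * m * (p * t - q * s) * (q * s + p * t)
      - q ^ 2 * m * s * (o * s - p * m)) * (z0 * z1 * z2)

theorem pentF_3 (o p q m s t : ℝ) : pentF o p q m s t o p q = 0 := by unfold pentF; ring
theorem pentF_4 (o p q m s t : ℝ) : pentF o p q m s t m s t = 0 := by unfold pentF; ring

theorem pentF_01 (o p q m s t D τ : ℝ) : pentF o p q m s t ((1 - τ) * D) (τ * D) 0 =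
    τ * (1 - τ) * D ^ 3 * (q * (p * t - q * s) * o * t) * ((1 - τ) * (-s) + τ * m) := by
  unfold pentF; ring
theorem pentF_12 (o p q m s t D τ : ℝ) : pentF o p q m s t 0 ((1 - τ) * D) (τ * D) =
    τ * (1 - τ) * D ^ 3 * (-(o * t * m * (o * s - p * m))) * ((1 - τ) * (-q) + τ * p) := by
  unfold pentF; ring
theorem pentF_02 (o p q m s t D τ : ℝ) : pentF o p q m s t ((1 - τ) * D) 0 (τ * D) =
    τ * (1 - τ) * D ^ 3 * (s * q * p * m) *
      ((1 - τ) * (p * t - q * s) + τ * (o * s - p * m)) := by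
  unfold pentF; ring
theorem pentF_14 (o p q m s t D τ : ℝ) :
    pentF o p q m s t (τ * m) ((1 - τ) * D + τ * s) (τ * t) =
    τ * (1 - τ) * D * (-(s * t * q * m * (q * m - o * t))) *
      ((1 - τ) * D * o + τ * (o * s - p * m)) := by
  unfold pentF; ring
theorem pentF_04 (o p q m s t D τ : ℝ) :
    pentF o p q m s t ((1 - τ) * D + τ * m) (τ * s) (τ * t) =
    τ * (1 - τ) * D * (-(s * t * (p * t - q * s) * (o * s - p * m))) *
      ((1 - τ) * D * q + τ * (q * m - o * t)) := by
  unfold pentF; ring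

theorem pent (a0 a1 a2 a3 a4 : Pt) (h012 : 0 < ori a0 a1 a2) (h013 : 0 < ori a0 a1 a3)
    (h014 : 0 < ori a0 a1 a4) (h024 : 0 < ori a0 a2 a4)
    (h034 : 0 < ori a0 a3 a4) (h123 : 0 < ori a1 a2 a3) (h124 : 0 < ori a1 a2 a4) :
    ∃ c : Fin 10 → ℝ, c ≠ 0 ∧ cubv c (a0 0) (a0 1) = 0 ∧ cubv c (a1 0) (a1 1) = 0 ∧
      cubv c (a2 0) (a2 1) = 0 ∧ cubv c (a3 0) (a3 1) = 0 ∧ cubv c (a4 0) (a4 1) = 0 ∧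
      (∀ r, ori a0 a1 r = 0 → ori a2 a4 r = 0 → cubv c (r 0) (r 1) = 0) ∧
      (∀ r, ori a1 a2 r = 0 → ori a0 a3 r = 0 → cubv c (r 0) (r 1) = 0) ∧
      (∀ r, ori a0 a2 r = 0 → ori a3 a4 r = 0 → cubv c (r 0) (r 1) = 0) ∧
      (∀ r, ori a1 a4 r = 0 → ori a2 a3 r = 0 → cubv c (r 0) (r 1) = 0) ∧
      (∀ r, ori a0 a4 r = 0 → ori a1 a3 r = 0 → cubv c (r 0) (r 1) = 0) := by
  have hne : ∀ a b c : Pt, 0 < ori a b c → a ≠ b := by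
    rintro a b c h rfl; unfold ori at h; simp at h
  have hne' : ∀ a b c : Pt, 0 < ori a b c → b ≠ c := by
    rintro a b c h rfl; unfold ori at h
    rw [mul_comm, sub_self] at h
    exact lt_irrefl _ h
  have hne'' : ∀ a b c : Pt, 0 < ori a b c → a ≠ c := by
    rintro a b c h rfl; unfold ori at h; simp at h
  have hcub : IsCub (fun z => pentF (ori a1 a2 a3) (ori a2 a0 a3) (ori a0 a1 a3)
      (ori a1 a2 a4) (ori a2 a0 a4) (ori a0 a1 a4) (ori a1 a2 z) (ori a2 a0 z) (ori a0 a1 z)) := by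
    unfold pentF
    exact isCub_add (isCub_add (isCub_add (isCub_add (isCub_add (isCub_add
      (isCub_prod _ _ _ _ _ _ _) (isCub_prod _ _ _ _ _ _ _)) (isCub_prod _ _ _ _ _ _ _))
      (isCub_prod _ _ _ _ _ _ _)) (isCub_prod _ _ _ _ _ _ _)) (isCub_prod _ _ _ _ _ _ _))
      (isCub_prod _ _ _ _ _ _ _)
  obtain ⟨c, hc⟩ := hcub
  beta_reduce at hc
  obtain ⟨D, hD⟩ : ∃ D, D = ori a0 a1 a2 := ⟨_, rfl⟩
  have oself1 : ∀ a b : Pt, ori a b a = 0 := by intro a b; unfold ori; ring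
  have oself2 : ∀ a b : Pt, ori a b b = 0 := by intro a b; unfold ori; ring
  have X : ori a2 a0 a3 * ori a0 a1 a4 - ori a0 a1 a3 * ori a2 a0 a4 = D * ori a0 a3 a4 := by
    rw [hD]; unfold ori; ring
  have Y : ori a1 a2 a3 * ori a2 a0 a4 - ori a2 a0 a3 * ori a1 a2 a4 = D * ori a2 a3 a4 := by
    rw [hD]; unfold ori; ring
  have W : ori a0 a1 a3 * ori a1 a2 a4 - ori a1 a2 a3 * ori a0 a1 a4 = D * ori a1 a3 a4 := by
    rw [hD]; unfold ori; ring
  refine ⟨c, ?_, ?_, ?_, ?_, ?_, ?_, ?_, ?_, ?_, ?_, ?_⟩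
  · rintro rfl
    have := hc (fun i => a0 i + (1 / 2) * (a1 i - a0 i))
    have b0 : ori a1 a2 (fun i => a0 i + (1 / 2) * (a1 i - a0 i)) = (1 - 1 / 2) * D := by
      rw [hD]; unfold ori; ring
    have b1 : ori a2 a0 (fun i => a0 i + (1 / 2) * (a1 i - a0 i)) = (1 / 2) * D := by
      rw [hD]; unfold ori; ring
    have b2 : ori a0 a1 (fun i => a0 i + (1 / 2) * (a1 i - a0 i)) = 0 := by
      unfold ori; ring
    simp only [b0, b1, b2] at this
    rw [pentF_01, X] at this
    have hs : ori a2 a0 a4 = - ori a0 a2 a4 := by unfold ori; ring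
    rw [hs] at this
    rw [← hD] at h012
    have h1 : 0 < (1 - 1 / 2 : ℝ) * - - ori a0 a2 a4 + 1 / 2 * ori a1 a2 a4 := by
      rw [neg_neg]; linarith
    have h2 : 0 < (1 / 2 : ℝ) * (1 - 1 / 2) * D ^ 3 *
      (ori a0 a1 a3 * (D * ori a0 a3 a4) * ori a1 a2 a3 * ori a0 a1 a4) := by positivity
    have h3 := mul_pos h2 h1
    rw [← this] at h3
    simp [cubv] at h3
  · rw [hc]; simp only [oself1, oself2]; unfold pentF; ring
  · rw [hc]; simp only [oself1, oself2]; unfold pentF; ring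
  · rw [hc]; simp only [oself1, oself2]; unfold pentF; ring
  · rw [hc, pentF_3]
  · rw [hc, pentF_4]
  · intro r h1 h2
    obtain ⟨τ, hτ⟩ := param (hne _ _ _ h012) h1
    have b0 : ori a1 a2 r = (1 - τ) * D := by rw [hD]; simp only [ori, hτ]; ring
    have b1 : ori a2 a0 r = τ * D := by rw [hD]; simp only [ori, hτ]; ring
    have b2 : ori a0 a1 r = 0 := h1
    have hh : ori a2 a4 r = (1 - τ) * (- ori a2 a0 a4) + τ * ori a1 a2 a4 := by
      simp only [ori, hτ]; ring
    rw [hc, b0, b1, b2, pentF_01, ← hh, h2, mul_zero]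
  · intro r h1 h2
    obtain ⟨τ, hτ⟩ := param (hne' _ _ _ h012) h1
    have b0 : ori a1 a2 r = 0 := h1
    have b1 : ori a2 a0 r = (1 - τ) * D := by rw [hD]; simp only [ori, hτ]; ring
    have b2 : ori a0 a1 r = τ * D := by rw [hD]; simp only [ori, hτ]; ring
    have hh : ori a0 a3 r = (1 - τ) * (- ori a0 a1 a3) + τ * ori a2 a0 a3 := by
      simp only [ori, hτ]; ring
    rw [hc, b0, b1, b2, pentF_12, ← hh, h2, mul_zero]
  · intro r h1 h2
    obtain ⟨τ, hτ⟩ := param (hne'' _ _ _ h012) h1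
    have b0 : ori a1 a2 r = (1 - τ) * D := by rw [hD]; simp only [ori, hτ]; ring
    have b1 : ori a2 a0 r = 0 := by rw [← neg_zero, ← h1]; unfold ori; ring
    have b2 : ori a0 a1 r = τ * D := by rw [hD]; simp only [ori, hτ]; ring
    have hh : D * ori a3 a4 r = (1 - τ) * (D * ori a0 a3 a4) + τ * (D * ori a2 a3 a4) := by
      rw [hD]; simp only [ori, hτ]; ring
    rw [hc, b0, b1, b2, pentF_02, X, Y, ← hh, h2, mul_zero, mul_zero]
  · intro r h1 h2
    obtain ⟨τ, hτ⟩ := param (hne'' _ _ _ h124) h1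
    have b0 : ori a1 a2 r = τ * ori a1 a2 a4 := by simp only [ori, hτ]; ring
    have b1 : ori a2 a0 r = (1 - τ) * D + τ * ori a2 a0 a4 := by
      rw [hD]; simp only [ori, hτ]; ring
    have b2 : ori a0 a1 r = τ * ori a0 a1 a4 := by simp only [ori, hτ]; ring
    have hh : D * ori a2 a3 r = (1 - τ) * D * ori a1 a2 a3 + τ * (D * ori a2 a3 a4) := by
      simp only [ori, hτ]; ring
    rw [hc, b0, b1, b2, pentF_14, Y, ← hh, h2, mul_zero, mul_zero]
  · intro r h1 h2
    obtain ⟨τ, hτ⟩ := param (hne'' _ _ _ h014) h1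
    have b0 : ori a1 a2 r = (1 - τ) * D + τ * ori a1 a2 a4 := by
      rw [hD]; simp only [ori, hτ]; ring
    have b1 : ori a2 a0 r = τ * ori a2 a0 a4 := by simp only [ori, hτ]; ring
    have b2 : ori a0 a1 r = τ * ori a0 a1 a4 := by simp only [ori, hτ]; ring
    have hh : D * ori a1 a3 r = (1 - τ) * D * ori a0 a1 a3 + τ * (D * ori a1 a3 a4) := by
      simp only [ori, hτ]; ring
    rw [hc, b0, b1, b2, pentF_04, W, ← hh, h2, mul_zero, mul_zero]

/-- There is a nonzero cubic through any nine points. -/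
theorem exists_cub9 (s : Fin 9 → Pt) :
    ∃ c : Fin 10 → ℝ, c ≠ 0 ∧ ∀ i, cubv c (s i 0) (s i 1) = 0 := by
  let T : (Fin 10 → ℝ) →ₗ[ℝ] (Fin 9 → ℝ) :=
    { toFun := fun c i => cubv c (s i 0) (s i 1)
      map_add' := by intro a b; funext i; simp [cubv]; ring
      map_smul' := by intro a b; funext i; simp [cubv]; ring }
  have : LinearMap.ker T ≠ ⊥ := LinearMap.ker_ne_bot_of_finrank_lt (by simp)
  obtain ⟨c, hc, hc0⟩ := (Submodule.ne_bot_iff _).1 this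
  exact ⟨c, hc0, fun i => congrFun (LinearMap.mem_ker.1 hc) i⟩

theorem exists_cub_finset (S : Finset Pt) (hS : S.card ≤ 9) :
    ∃ c : Fin 10 → ℝ, c ≠ 0 ∧ ∀ z ∈ S, cubv c (z 0) (z 1) = 0 := by
  obtain ⟨c, h0, hc⟩ := exists_cub9 (fun i => S.toList.getD i 0)
  refine ⟨c, h0, fun z hz => ?_⟩
  obtain ⟨k, hk, hz'⟩ := List.getElem_of_mem (Finset.mem_toList.2 hz)
  have hk9 : k < 9 := by rw [Finset.length_toList] at hk; omega
  have := hc ⟨k, hk9⟩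
  simp only [List.getD_eq_getElem _ _ hk, hz'] at this
  exact this

open MvPolynomial in
theorem to_mv (c : Fin 10 → ℝ) (hc : c ≠ 0) :
    ∃ f : MvPolynomial (Fin 2) ℝ, f ≠ 0 ∧ f.totalDegree ≤ 3 ∧
      ∀ p : Pt, MvPolynomial.eval p f = cubv c (p 0) (p 1) := by
  let mon : ℝ → ℕ → ℕ → MvPolynomial (Fin 2) ℝ := fun a i j => C a * (X 0 ^ i * X 1 ^ j)
  have hmon : ∀ a i j, i + j ≤ 3 → (mon a i j).totalDegree ≤ 3 := by
    intro a i j hij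
    refine (totalDegree_mul _ _).trans ?_
    rw [totalDegree_C, zero_add]
    refine (totalDegree_mul _ _).trans ?_
    rw [totalDegree_X_pow, totalDegree_X_pow]
    exact hij
  let f := mon (c 0) 0 0 + mon (c 1) 1 0 + mon (c 2) 0 1 + mon (c 3) 2 0 + mon (c 4) 1 1
    + mon (c 5) 0 2 + mon (c 6) 3 0 + mon (c 7) 2 1 + mon (c 8) 1 2 + mon (c 9) 0 3
  have hev : ∀ p : Pt, MvPolynomial.eval p f = cubv c (p 0) (p 1) := by
    intro p
    simp [f, mon, cubv]
  have hadd : ∀ g h : MvPolynomial (Fin 2) ℝ, g.totalDegree ≤ 3 → h.totalDegree ≤ 3 →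
      (g + h).totalDegree ≤ 3 := fun g h h1 h2 => (totalDegree_add g h).trans (max_le h1 h2)
  refine ⟨f, ?_, ?_, hev⟩
  · intro hf
    apply hc
    have h : ∀ x y : ℝ, cubv c x y = 0 := by
      intro x y
      have := hev ![x, y]
      rw [hf] at this
      simpa using this.symm
    have e0 := h 0 0
    have e1 := h 1 0
    have e2 := h (-1) 0
    have e3 := h 2 0
    have e4 := h 0 1
    have e5 := h 0 (-1)
    have e6 := h 0 2
    have e7 := h 1 1
    have e8 := h 1 (-1)
    have e9 := h (-1) 1
    unfold cubv at e0 e1 e2 e3 e4 e5 e6 e7 e8 e9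
    norm_num at e0 e1 e2 e3 e4 e5 e6 e7 e8 e9
    funext i
    fin_cases i <;> simp <;> linarith
  · exact hadd _ _ (hadd _ _ (hadd _ _ (hadd _ _ (hadd _ _ (hadd _ _ (hadd _ _ (hadd _ _ (hadd _ _
      (hmon _ _ _ (by norm_num)) (hmon _ _ _ (by norm_num))) (hmon _ _ _ (by norm_num)))
      (hmon _ _ _ (by norm_num))) (hmon _ _ _ (by norm_num))) (hmon _ _ _ (by norm_num)))
      (hmon _ _ _ (by norm_num))) (hmon _ _ _ (by norm_num))) (hmon _ _ _ (by norm_num)))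
      (hmon _ _ _ (by norm_num))


/-- The point r is on the line ab outside the segment. -/
def Out (a b r : Pt) : Prop := ∃ t : ℝ, (t < 0 ∨ 1 < t) ∧ ∀ i, r i = a i + t * (b i - a i)

theorem Out.symm {a b r : Pt} (h : Out a b r) : Out b a r := by
  obtain ⟨t, ht, h⟩ := h
  refine ⟨1 - t, by rcases ht with h | h <;> [right; left] <;> linarith, fun i => ?_⟩
  rw [h]; ring

theorem Out.ori {a b r : Pt} (h : Out a b r) : ori a b r = 0 := by
  obtain ⟨t, ht, h⟩ := h
  simp only [_root_.ori, h]; ring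

theorem ori_rot (a b c : Pt) : ori a b c = ori b c a := by unfold ori; ring
theorem ori_sw (a b c : Pt) : ori a b c = - ori a c b := by unfold ori; ring
theorem ori_sw1 (a b c : Pt) : ori a b c = - ori b a c := by unfold ori; ring
theorem ori_self1 (a b : Pt) : ori a a b = 0 := by unfold ori; ring
theorem ori_self2 (a b : Pt) : ori a b a = 0 := by unfold ori; ring
theorem ori_self3 (a b : Pt) : ori a b b = 0 := by unfold ori; ring

theorem ori_ne {a b c : Pt} (h : ori a b c ≠ 0) : a ≠ b ∧ a ≠ c ∧ b ≠ c := by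
  refine ⟨?_, ?_, ?_⟩ <;> rintro rfl <;> apply h
  · exact ori_self1 _ _
  · exact ori_self2 _ _
  · exact ori_self3 _ _

theorem line_inter {a b c r : Pt} (h1 : ori a b r = 0) (h2 : ori a c r = 0) (h : ori a b c ≠ 0) :
    r = a := by
  obtain ⟨t, ht⟩ := param (ori_ne h).1 h1
  have : t * ori a b c = 0 := by
    have : ori a c r = - (t * ori a b c) := by simp only [ori, ht]; ring
    linarith
  have t0 : t = 0 := by simpa [h] using this
  funext i; rw [ht, t0]; ring

theorem ns1 {a b c r : Pt} (h1 : Out a b r) (h2 : Out a c r) (h : ori a b c ≠ 0) : r = a :=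
  line_inter h1.ori h2.ori h

theorem ns2 {a b c d r : Pt} (h1 : Out a b r) (h2 : Out c d r) (h : ori a b c * ori a b d < 0) :
    False := by
  have h1 := h1.ori
  obtain ⟨t, ht, hr⟩ := h2
  have e : ori a b r = (1 - t) * ori a b c + t * ori a b d := by simp only [ori, hr]; ring
  rw [h1] at e
  set x := ori a b c
  set y := ori a b d
  have e1 : (1 - t) * x * x = - t * (x * y) := by linear_combination (-x) * e
  have e2 : (1 - t) * (x * y) = - t * (y * y) := by linear_combination (-y) * e
  have hx : 0 < x * x := by
    have : x ≠ 0 := by intro h0; rw [h0] at h; simp at h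
    exact mul_self_pos.2 this
  have hy : 0 < y * y := by
    have : y ≠ 0 := by intro h0; rw [h0] at h; simp at h
    exact mul_self_pos.2 this
  rcases ht with ht | ht
  · nlinarith [mul_pos (sub_pos.2 (lt_trans ht one_pos)) hx, mul_pos_of_neg_of_neg ht h]
  · nlinarith [mul_pos (sub_pos.2 ht) hx, mul_pos (sub_pos.2 ht) (neg_pos.2 h)]

structure Cfg (n : ℕ) (P R : Finset Pt) (rr : Pt → Pt → Pt) : Prop where
  cP : P.card = n
  cR : R.card = n
  gp : ∀ x ∈ P, ∀ y ∈ P, ∀ z ∈ P, x ≠ y → x ≠ z → y ≠ z → ori x y z ≠ 0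
  dj : ∀ x ∈ P, x ∉ R
  mem : ∀ x ∈ P, ∀ y ∈ P, x ≠ y → rr x y ∈ R
  out : ∀ x ∈ P, ∀ y ∈ P, x ≠ y → Out x y (rr x y)

theorem collinear_of_ori {a b c : Pt} (hab : a ≠ b) (h : ori a b c = 0) :
    Collinear ℝ ({a, b, c} : Set Pt) := by
  obtain ⟨t, ht⟩ := param hab h
  rw [collinear_iff_of_mem (p₀ := a) (by simp)]
  refine ⟨b - a, ?_⟩
  intro p hp
  simp only [Set.mem_insert_iff, Set.mem_singleton_iff] at hp
  rcases hp with rfl | rfl | rfl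
  · exact ⟨0, by simp⟩
  · exact ⟨1, by simp⟩
  · refine ⟨t, ?_⟩
    funext i; simp [ht]; ring

theorem out_of_collinear {a b r : Pt} (hab : a ≠ b) (h : Collinear ℝ ({a, b, r} : Set Pt))
    (hs : r ∉ segment ℝ a b) : Out a b r := by
  rw [collinear_iff_of_mem (p₀ := a) (by simp)] at h
  obtain ⟨v, hv⟩ := h
  obtain ⟨s, hs1⟩ := hv b (by simp)
  obtain ⟨u, hu⟩ := hv r (by simp)
  have s0 : s ≠ 0 := by
    rintro rfl; apply hab; rw [hs1]; simp
  have key : ∀ i, r i = a i + (u / s) * (b i - a i) := by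
    intro i; rw [hs1, hu]; simp; field_simp; ring
  refine ⟨u / s, ?_, key⟩
  by_contra hcon
  push Not at hcon
  apply hs
  refine ⟨1 - u / s, u / s, by linarith, hcon.1, by ring, ?_⟩
  funext i; simp only [Pi.add_apply, Pi.smul_apply, smul_eq_mul, key]; ring

theorem exists_cfg (n : ℕ) (P R : Finset Pt) (hPcard : P.card = n) (hRcard : R.card = n)
    (hgp : GenPos ↑P) (hdisj : Disjoint P R)
    (hpierce : ∀ x ∈ P, ∀ y ∈ P, x ≠ y →
      ∃ r ∈ R, Collinear ℝ ({x, y, r} : Set Pt) ∧ r ∉ segment ℝ x y) :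
    ∃ rr, Cfg n P R rr := by
  have : ∀ x y, ∃ r, x ∈ P → y ∈ P → x ≠ y → r ∈ R ∧ Out x y r := by
    intro x y
    by_cases hx : x ∈ P ∧ y ∈ P ∧ x ≠ y
    · obtain ⟨r, h1, h2, h3⟩ := hpierce x hx.1 y hx.2.1 hx.2.2
      exact ⟨r, fun _ _ _ => ⟨h1, out_of_collinear hx.2.2 h2 h3⟩⟩
    · exact ⟨x, fun a b c => absurd ⟨a, b, c⟩ hx⟩
  choose rr hrr using this
  refine ⟨rr, hPcard, hRcard, ?_, ?_, fun x hx y hy h => (hrr x y hx hy h).1,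
    fun x hx y hy h => (hrr x y hx hy h).2⟩
  · intro x hx y hy z hz h1 h2 h3 h
    exact hgp x hx y hy z hz h1 h2 h3 (collinear_of_ori h1 h)
  · intro x hx hx'
    exact Finset.disjoint_left.1 hdisj hx hx'

namespace Cfg
variable {n : ℕ} {P R : Finset Pt} {rr : Pt → Pt → Pt}

/-- Edges sharing a vertex have distinct blockers. -/
theorem share (C : Cfg n P R rr) {a b c r : Pt} (ha : a ∈ P) (hb : b ∈ P) (hc : c ∈ P)
    (hab : a ≠ b) (hac : a ≠ c) (hbc : b ≠ c) (h1 : Out a b r) (h2 : Out a c r) (hr : r ∈ R) :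
    False := by
  have := ns1 h1 h2 (C.gp a ha b hb c hc hab hac hbc)
  exact C.dj a ha (this ▸ hr)

/-- a point with the star -/
theorem flip {P : Finset Pt} {p : Pt} : ∀ (m : ℕ) (x y : Pt), x ∈ P → y ∈ P →
    0 < ori p x y → (P.filter (fun z => 0 < ori p z x * ori p z y)).card ≤ m →
    ∃ x' ∈ P, ∃ y' ∈ P, 0 < ori p x' y' ∧ (∀ z ∈ P, ¬ (0 < ori p z x' * ori p z y')) ∧
      ∃ s t s' t' : ℝ, 0 < s ∧ 0 ≤ t ∧ 0 < s' ∧ 0 ≤ t' ∧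
        (∀ i, x' i - p i = s * (x i - p i) - t * (y i - p i)) ∧
        (∀ i, y' i - p i = s' * (y i - p i) - t' * (x i - p i)) := by
  intro m
  induction m with
  | zero =>
    intro x y hx hy hxy hm
    refine ⟨x, hx, y, hy, hxy, ?_, 1, 0, 1, 0, by norm_num, le_rfl, by norm_num, le_rfl, ?_, ?_⟩
    · intro z hz h
      have := Finset.card_eq_zero.1 (Nat.le_zero.1 hm)
      have h2 : z ∈ (P.filter (fun z => 0 < ori p z x * ori p z y)) := by simp [hz, h]
      rw [this] at h2; simp at h2
    · intro i; ring
    · intro i; ring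
  | succ m ih =>
    intro x y hx hy hxy hm
    by_cases hgood : ∀ z ∈ P, ¬ (0 < ori p z x * ori p z y)
    · exact ⟨x, hx, y, hy, hxy, hgood, 1, 0, 1, 0, by norm_num, le_rfl, by norm_num, le_rfl,
        fun i => by ring, fun i => by ring⟩
    push Not at hgood
    obtain ⟨z, hz, hbad⟩ := hgood
    have hzmem : z ∈ (P.filter (fun z => 0 < ori p z x * ori p z y)) := by simp [hz, hbad]
    obtain ⟨D, hD⟩ : ∃ D, D = ori p x y := ⟨_, rfl⟩
    rw [← hD] at hxy
    have pl : ∀ w, ori p w z * D = ori p w x * ori p z y - ori p w y * ori p z x := by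
      intro w; rw [hD]; unfold ori; ring
    have hzc : ∀ i, z i - p i = (ori p z y / D) * (x i - p i) - (ori p z x / D) * (y i - p i) := by
      intro i
      have : D * (z i - p i) = ori p z y * (x i - p i) - ori p z x * (y i - p i) := by
        rw [hD]; unfold ori; fin_cases i <;> simp <;> ring
      field_simp; linarith
    rcases pos_and_pos_or_neg_and_neg_of_mul_pos hbad with ⟨b1, b2⟩ | ⟨b1, b2⟩
    · have hlt : (P.filter (fun w => 0 < ori p w z * ori p w y)).card ≤ m := by
        apply Nat.lt_succ_iff.1
        refine lt_of_lt_of_le (Finset.card_lt_card ?_) hm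
        refine Finset.ssubset_iff_subset_ne.2 ⟨?_, ?_⟩
        · intro w hw
          simp only [Finset.mem_filter] at hw ⊢
          refine ⟨hw.1, ?_⟩
          have h1 := pl w
          rcases pos_and_pos_or_neg_and_neg_of_mul_pos hw.2 with ⟨c1, c2⟩ | ⟨c1, c2⟩
          · refine mul_pos ?_ c2
            by_contra hcon
            push Not at hcon
            nlinarith [mul_pos c1 hxy, mul_pos c2 b1]
          · refine mul_pos_of_neg_of_neg ?_ c2
            by_contra hcon
            push Not at hcon
            nlinarith [mul_pos (neg_pos.2 c1) hxy, mul_pos (neg_pos.2 c2) b1, mul_nonneg hcon b2.le]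
        · intro he
          rw [← he] at hzmem
          simp [ori_self3] at hzmem
      obtain ⟨x', hx', y', hy', g1, g2, s, t, s', t', q1, q2, q3, q4, q5, q6⟩ := ih z y hz hy b2 hlt
      have k1 : 0 < ori p z y / D := by positivity
      have k2 : 0 < ori p z x / D := by positivity
      refine ⟨x', hx', y', hy', g1, g2, s * (ori p z y / D), s * (ori p z x / D) + t,
        s' + t' * (ori p z x / D), t' * (ori p z y / D), by positivity, by positivity,
        by positivity, by positivity, ?_, ?_⟩
      · intro i; rw [q5, hzc]; ring
      · intro i; rw [q6, hzc]; ring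
    · have hlt : (P.filter (fun w => 0 < ori p w x * ori p w z)).card ≤ m := by
        apply Nat.lt_succ_iff.1
        refine lt_of_lt_of_le (Finset.card_lt_card ?_) hm
        refine Finset.ssubset_iff_subset_ne.2 ⟨?_, ?_⟩
        · intro w hw
          simp only [Finset.mem_filter] at hw ⊢
          refine ⟨hw.1, ?_⟩
          have h1 := pl w
          rcases pos_and_pos_or_neg_and_neg_of_mul_pos hw.2 with ⟨c1, c2⟩ | ⟨c1, c2⟩
          · refine mul_pos c1 ?_
            by_contra hcon
            push Not at hcon
            nlinarith [mul_pos c2 hxy, mul_pos c1 (neg_pos.2 b2),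
              mul_nonneg (neg_nonneg.2 hcon) (neg_pos.2 b1).le]
          · refine mul_pos_of_neg_of_neg c1 ?_
            by_contra hcon
            push Not at hcon
            nlinarith [mul_pos (neg_pos.2 c2) hxy, mul_pos (neg_pos.2 c1) (neg_pos.2 b2),
              mul_nonneg hcon (neg_pos.2 b1).le]
        · intro he
          rw [← he] at hzmem
          simp [ori_self3] at hzmem
      have b1' : 0 < ori p x z := by rw [ori_sw]; linarith
      obtain ⟨x', hx', y', hy', g1, g2, s, t, s', t', q1, q2, q3, q4, q5, q6⟩ := ih x z hx hz b1' hlt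
      have k1 : 0 < - ori p z y / D := div_pos (by linarith) hxy
      have k2 : 0 < - ori p z x / D := div_pos (by linarith) hxy
      refine ⟨x', hx', y', hy', g1, g2, s + t * (- ori p z y / D), t * (- ori p z x / D),
        s' * (- ori p z x / D), s' * (- ori p z y / D) + t', by positivity, by positivity,
        by positivity, by positivity, ?_, ?_⟩
      · intro i; rw [q5, hzc]; ring
      · intro i; rw [q6, hzc]; ring

end Cfg


namespace Cfg
variable {n : ℕ} {P R : Finset Pt} {rr : Pt → Pt → Pt}

/-- Star edges and good edges have distinct blockers. -/
theorem star_good (C : Cfg n P R rr) {p x y z : Pt} (hp : p ∈ P) (hx : x ∈ P) (hy : y ∈ P)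
    (hz : z ∈ P) (hzp : p ≠ z) (hxy : 0 < ori p x y) (hg : ¬ (0 < ori p z x * ori p z y)) :
    rr p z ≠ rr x y := by
  intro h
  obtain ⟨n1, n2, n3⟩ := ori_ne hxy.ne'
  have o1 := C.out p hp z hz hzp
  have o2 := C.out x hx y hy n3
  have m2 := C.mem x hx y hy n3
  rw [h] at o1
  by_cases h1 : z = x
  · subst h1
    exact C.share hz hp hy n1.symm n3 n2 o1.symm o2 m2
  by_cases h2 : z = y
  · subst h2
    exact C.share hz hp hx n2.symm n3.symm n1 o1.symm o2.symm m2
  refine ns2 o1 o2 ?_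
  have g1 := C.gp p hp z hz x hx hzp n1 h1
  have g2 := C.gp p hp z hz y hy hzp n2 h2
  exact lt_of_le_of_ne (not_lt.1 hg) (mul_ne_zero g1 g2)

theorem star_star (C : Cfg n P R rr) {p x y : Pt} (hp : p ∈ P) (hx : x ∈ P) (hy : y ∈ P)
    (hxp : p ≠ x) (hyp : p ≠ y) (h : x ≠ y) : rr p x ≠ rr p y := by
  intro he
  have o1 := C.out p hp x hx hxp
  have o2 := C.out p hp y hy hyp
  rw [he] at o1
  exact C.share hp hx hy hxp hyp h o1 o2 (C.mem p hp y hy hyp)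

theorem no_inner (C : Cfg n P R rr) {p a b c : Pt} (hp : p ∈ P) (ha : a ∈ P) (hb : b ∈ P)
    (hc : c ∈ P) (h1 : 0 < ori p a b) (h2 : 0 < ori p b c) (h3 : 0 < ori p c a) : False := by
  obtain ⟨x, hx, y, hy, E0, g1, s, t, s', t', q1, q2, q3, q4, q5, q6⟩ := flip (P := P) _ a b ha hb h1 le_rfl
  obtain ⟨x2, hx2, y2, hy2, F0, g2, u, v, u', v', w1, w2, w3, w4, w5, w6⟩ :=
    flip (P := P) _ b c hb hc h2 le_rfl
  have A0 : 0 < ori p x x2 := by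
    have : ori p x x2 = s * u * ori p a b + s * v * ori p c a + t * v * ori p b c := by
      simp only [ori, q5, w5]; ring
    rw [this]; positivity
  have C0 : 0 < ori p y y2 := by
    have : ori p y y2 = s' * u' * ori p b c + t' * u' * ori p c a + t' * v' * ori p a b := by
      simp only [ori, q6, w6]; ring
    rw [this]; positivity
  have D0 : 0 < ori p y2 x := by
    have : ori p y2 x = u' * s * ori p c a + u' * t * ori p b c + v' * s * ori p a b := by
      simp only [ori, q5, w6]; ring
    rw [this]; positivity
  have B0 : 0 ≤ ori p x2 y := by
    have : ori p x2 y = u * t' * ori p a b + v * s' * ori p b c + v * t' * ori p c a := by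
      simp only [ori, q6, w5]; ring
    rw [this]; positivity
  obtain ⟨n1, n2, n3⟩ := ori_ne E0.ne'
  obtain ⟨m1, m2, m3⟩ := ori_ne F0.ne'
  have key : rr x y ≠ rr x2 y2 := by
    intro he
    have o1 := C.out x hx y hy n3
    have o2 := C.out x2 hx2 y2 hy2 m3
    have mm := C.mem x2 hx2 y2 hy2 m3
    rw [he] at o1
    by_cases hB : x2 = y
    · subst hB
      exact C.share hx2 hx hy2 n3.symm m3 (ori_ne D0.ne').2.2.symm o1.symm o2 mm
    have B1 : 0 < ori p x2 y := lt_of_le_of_ne B0 (C.gp p hp x2 hx2 y hy m1 n2 hB).symm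
    have e1 : ori x y x2 = ori p x y - ori p x2 y - ori p x x2 := by unfold ori; ring
    have e2 : ori x y y2 = ori p x y + ori p y y2 + ori p y2 x := by unfold ori; ring
    have e3 : ori x2 y2 y = ori p x2 y2 - ori p y y2 - ori p x2 y := by unfold ori; ring
    have e4 : ori x2 y2 x = ori p x2 y2 + ori p y2 x + ori p x x2 := by unfold ori; ring
    have pl : ori p x y * ori p x2 y2 = ori p x x2 * ori p y y2 - ori p x2 y * ori p y2 x := by
      unfold ori; ring
    by_cases c1 : ori x y x2 < 0
    · refine ns2 o1 o2 (mul_neg_of_neg_of_pos c1 ?_)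
      rw [e2]; positivity
    by_cases c2 : ori x2 y2 y < 0
    · refine ns2 o2 o1.symm (mul_neg_of_neg_of_pos c2 ?_)
      rw [e4]; positivity
    rw [e1] at c1
    rw [e3] at c2
    generalize ori p x y = E at *
    generalize ori p x2 y2 = F at *
    generalize ori p x x2 = A' at *
    generalize ori p x2 y = B' at *
    generalize ori p y y2 = C' at *
    generalize ori p y2 x = D' at *
    have i1 : A' + B' ≤ E := by linarith
    have i2 : B' + C' ≤ F := by linarith
    have i3 : (A' + B') * (B' + C') ≤ E * F := mul_le_mul i1 i2 (by positivity) (by positivity)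
    nlinarith [mul_pos B1 D0, mul_pos A0 B1, mul_pos B1 B1, mul_pos B1 C0]
  have inj : Set.InjOn (rr p) (P.erase p : Finset Pt) := by
    intro z hz w hw h
    simp only [Finset.coe_erase, Set.mem_sdiff, Finset.mem_coe, Set.mem_singleton_iff] at hz hw
    by_contra hne
    exact C.star_star hp hz.1 hw.1 (Ne.symm hz.2) (Ne.symm hw.2) hne h
  have c1 : ((P.erase p).image (rr p)).card = P.card - 1 := by
    rw [Finset.card_image_of_injOn inj, Finset.card_erase_of_mem hp]
  have c2 : rr x2 y2 ∉ (P.erase p).image (rr p) := by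
    intro h
    simp only [Finset.mem_image, Finset.mem_erase] at h
    obtain ⟨z, hz, h⟩ := h
    exact C.star_good hp hx2 hy2 hz.2 (Ne.symm hz.1) F0 (g2 z hz.2) h
  have c3 : rr x y ∉ insert (rr x2 y2) ((P.erase p).image (rr p)) := by
    intro h
    simp only [Finset.mem_insert, Finset.mem_image, Finset.mem_erase] at h
    rcases h with h | ⟨z, hz, h⟩
    · exact key h
    exact C.star_good hp hx hy hz.2 (Ne.symm hz.1) E0 (g1 z hz.2) h
  have sub : insert (rr x y) (insert (rr x2 y2) ((P.erase p).image (rr p))) ⊆ R := by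
    intro w hw
    simp only [Finset.mem_insert, Finset.mem_image, Finset.mem_erase] at hw
    rcases hw with rfl | rfl | ⟨z, hz, rfl⟩
    · exact C.mem x hx y hy n3
    · exact C.mem x2 hx2 y2 hy2 m3
    · exact C.mem p hp z hz.2 (Ne.symm hz.1)
  have := Finset.card_le_card sub
  rw [Finset.card_insert_of_notMem c3, Finset.card_insert_of_notMem c2, c1, C.cR, C.cP] at this
  have : 0 < P.card := Finset.card_pos.2 ⟨p, hp⟩
  have := C.cP
  omega

end Cfg


/-- Cyclic labelling of the points in convex position. -/
structure Lab (n : ℕ) (P : Finset Pt) (v : ℕ → Pt) : Prop where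
  per : ∀ k, v (k + n) = v k
  mem : ∀ k, v k ∈ P
  surj : ∀ a ∈ P, ∃ i, i < n ∧ v i = a
  pos : ∀ i j k, i < j → j < k → k < i + n → 0 < ori (v i) (v j) (v k)

namespace Cfg
variable {n : ℕ} {P R : Finset Pt} {rr : Pt → Pt → Pt}

theorem exists_lab (C : Cfg n P R rr) (hn : 0 < n) : ∃ v, Lab n P v := by
  have hne : P.Nonempty := Finset.card_pos.1 (by rw [C.cP]; exact hn)
  obtain ⟨p0, hp0, hmin⟩ := Finset.exists_min_image P (fun p => toLex (p 0, p 1)) hne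
  have hlex : ∀ a ∈ P, a ≠ p0 → 0 < a 0 - p0 0 ∨ (a 0 - p0 0 = 0 ∧ 0 < a 1 - p0 1) := by
    intro a ha hne
    have := hmin a ha
    rw [Prod.Lex.le_iff] at this
    simp at this
    rcases this with h | ⟨h1, h2⟩
    · left; linarith
    · right
      refine ⟨by linarith, ?_⟩
      rcases lt_or_eq_of_le h2 with h2 | h2
      · linarith
      · exact absurd (pt_ext h1.symm h2.symm) hne
  have htr : ∀ a ∈ P, ∀ b ∈ P, ∀ c ∈ P, a ≠ p0 → b ≠ p0 → c ≠ p0 → 0 < ori p0 a b →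
      0 < ori p0 b c → 0 < ori p0 a c := by
    intro a ha b hb c hc na nb nc h1 h2
    have hac : a ≠ c := by
      rintro rfl; rw [ori_sw] at h2; linarith
    have hg := C.gp p0 hp0 a ha c hc na.symm nc.symm hac
    have e : (b 0 - p0 0) * ori p0 a c = (a 0 - p0 0) * ori p0 b c + (c 0 - p0 0) * ori p0 a b := by
      unfold ori; ring
    have ha0 : 0 ≤ a 0 - p0 0 := by rcases hlex a ha na with h | h <;> linarith
    have hc0 : 0 ≤ c 0 - p0 0 := by rcases hlex c hc nc with h | h <;> linarith
    rcases hlex b hb nb with h | ⟨h, h'⟩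
    · refine lt_of_le_of_ne ?_ hg.symm
      have : 0 ≤ (b 0 - p0 0) * ori p0 a c := by rw [e]; positivity
      exact nonneg_of_mul_nonneg_right this h
    · exfalso
      unfold ori at h2
      rw [h] at h2
      nlinarith [mul_nonneg h'.le hc0]
  classical
  let f : Pt → ℕ := fun a => ((P.erase p0).filter (fun z => 0 < ori p0 z a)).card
  have flt : ∀ a ∈ P, ∀ b ∈ P, a ≠ p0 → b ≠ p0 → 0 < ori p0 a b → f a < f b := by
    intro a ha b hb na nb h
    apply Finset.card_lt_card
    rw [Finset.ssubset_iff_of_subset]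
    · refine ⟨a, by simp [ha, na, h], by simp [ori_self3]⟩
    · intro z hz
      simp only [Finset.mem_filter, Finset.mem_erase] at hz ⊢
      exact ⟨hz.1, htr z hz.1.2 a ha b hb hz.1.1 na nb hz.2 h⟩
  have flt' : ∀ a ∈ P, ∀ b ∈ P, a ≠ p0 → b ≠ p0 → f a < f b → 0 < ori p0 a b := by
    intro a ha b hb na nb h
    by_contra hcon
    have hab : a ≠ b := by rintro rfl; exact lt_irrefl _ h
    have := C.gp p0 hp0 a ha b hb na.symm nb.symm hab
    have h3 : 0 < ori p0 b a := by
      rw [ori_sw]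
      have := lt_of_le_of_ne (not_lt.1 hcon) this
      linarith
    exact absurd (flt b hb a ha nb na h3) (by omega)
  have finj : Set.InjOn f (P.erase p0 : Finset Pt) := by
    intro a ha b hb h
    simp only [Finset.coe_erase, Set.mem_sdiff, Finset.mem_coe, Set.mem_singleton_iff] at ha hb
    by_contra hab
    have := C.gp p0 hp0 a ha.1 b hb.1 (Ne.symm ha.2) (Ne.symm hb.2) hab
    rcases lt_or_gt_of_ne this with h1 | h1
    · rw [ori_sw] at h1
      have := flt b hb.1 a ha.1 hb.2 ha.2 (by linarith)
      omega
    · have := flt a ha.1 b hb.1 ha.2 hb.2 h1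
      omega
  have cer : (P.erase p0).card = n - 1 := by rw [Finset.card_erase_of_mem hp0, C.cP]
  have fran : (P.erase p0).image f = Finset.range (n - 1) := by
    apply Finset.eq_of_subset_of_card_le
    · intro k hk
      simp only [Finset.mem_image] at hk
      obtain ⟨a, ha, rfl⟩ := hk
      rw [Finset.mem_range, ← cer]
      apply Finset.card_lt_card
      rw [Finset.ssubset_iff_of_subset (Finset.filter_subset _ _)]
      exact ⟨a, ha, by simp [ori_self3]⟩
    · rw [Finset.card_image_of_injOn finj, cer, Finset.card_range]
  have hex : ∀ i, ∃ a, i < n → a ∈ P ∧ (i = 0 → a = p0) ∧ (0 < i → a ≠ p0 ∧ f a + 1 = i) := by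
    intro i
    by_cases hi : i = 0
    · exact ⟨p0, fun _ => ⟨hp0, fun _ => rfl, fun h => by omega⟩⟩
    by_cases hin : i < n
    · have : i - 1 ∈ (P.erase p0).image f := by rw [fran, Finset.mem_range]; omega
      rw [Finset.mem_image] at this
      obtain ⟨a, ha, hf⟩ := this
      rw [Finset.mem_erase] at ha
      exact ⟨a, fun _ => ⟨ha.2, fun h => absurd h hi, fun _ => ⟨ha.1, by omega⟩⟩⟩
    · exact ⟨p0, fun h => absurd h hin⟩
  choose v0 hv0 using hex
  have v00 : v0 0 = p0 := (hv0 0 hn).2.1 rfl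
  have ord : ∀ i j, 0 < i → i < j → j < n → 0 < ori p0 (v0 i) (v0 j) := by
    intro i j h0 h1 h2
    have a1 := hv0 i (by omega)
    have a2 := hv0 j h2
    have b1 := a1.2.2 h0
    have b2 := a2.2.2 (by omega)
    exact flt' _ a1.1 _ a2.1 b1.1 b2.1 (by omega)
  have pos0 : ∀ i j k, i < j → j < k → k < n → 0 < ori (v0 i) (v0 j) (v0 k) := by
    intro i j k h1 h2 h3
    by_cases hi : i = 0
    · subst hi; rw [v00]; exact ord j k (by omega) h2 h3
    have o1 := ord i j (by omega) h1 (by omega)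
    have o2 := ord j k (by omega) h2 h3
    have o3 := ord i k (by omega) (by omega) h3
    have mi := (hv0 i (by omega)).1
    have mj := (hv0 j (by omega)).1
    have mk := (hv0 k (by omega)).1
    by_contra hcon
    have g := C.gp _ mi _ mj _ mk (ori_ne o1.ne').2.2 (ori_ne o3.ne').2.2 (ori_ne o2.ne').2.2
    have hlt := lt_of_le_of_ne (not_lt.1 hcon) g
    refine C.no_inner mj hp0 mi mk ?_ ?_ ?_
    · rw [ori_rot]; exact o1
    · rw [ori_sw1]; linarith
    · rw [← ori_rot]; exact o2
  refine ⟨fun k => v0 (k % n), ?_, ?_, ?_, ?_⟩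
  · intro k; simp
  · intro k; exact (hv0 _ (Nat.mod_lt _ hn)).1
  · intro a ha
    by_cases hap : a = p0
    · exact ⟨0, hn, by simp [v00, hap]⟩
    · have : f a ∈ (P.erase p0).image f :=
        Finset.mem_image_of_mem _ (Finset.mem_erase.2 ⟨hap, ha⟩)
      rw [fran, Finset.mem_range] at this
      refine ⟨f a + 1, by omega, ?_⟩
      show v0 ((f a + 1) % n) = a
      rw [Nat.mod_eq_of_lt (by omega)]
      obtain ⟨m1, m2, m3⟩ := hv0 (f a + 1) (by omega)
      have := m3 (by omega)
      apply finj
      · simp [m1, this.1]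
      · simp [hap, ha]
      · omega
  · intro i j k hij hjk hk
    show 0 < ori (v0 (i % n)) (v0 (j % n)) (v0 (k % n))
    have hi := Nat.mod_lt i hn
    have hmod : ∀ m, i < m → m < i + n → (i % n < m % n ∧ m % n = i % n + (m - i)) ∨
        (m % n < i % n ∧ m % n + n = i % n + (m - i)) := by
      intro m h1 h2
      obtain ⟨d, rfl⟩ := Nat.exists_eq_add_of_lt h1
      have e : (i + d + 1) % n = (i % n + (d + 1)) % n := by
        rw [Nat.add_assoc, ← Nat.mod_add_mod]
      by_cases hlt : i % n + (d + 1) < n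
      · left; rw [e, Nat.mod_eq_of_lt hlt]; omega
      · right
        have : (i % n + (d + 1)) % n = i % n + (d + 1) - n := by
          rw [Nat.mod_eq_sub_mod (by omega), Nat.mod_eq_of_lt (by omega)]
        rw [e, this]; omega
    have hjn := Nat.mod_lt j hn
    have hkn := Nat.mod_lt k hn
    rcases hmod j hij (by omega) with ⟨a1, a2⟩ | ⟨a1, a2⟩ <;>
      rcases hmod k (by omega) hk with ⟨b1, b2⟩ | ⟨b1, b2⟩
    · exact pos0 _ _ _ a1 (by omega) hkn
    · rw [← ori_rot]; exact pos0 _ _ _ b1 a1 hjn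
    · omega
    · rw [ori_rot]; exact pos0 _ _ _ (by omega) b1 hi

end Cfg


theorem Lab.ne {n : ℕ} {P : Finset Pt} {v : ℕ → Pt} (L : Lab n P v) (hn : 3 ≤ n) {i j : ℕ}
    (h : i ≠ j) (h1 : i < j + n) (h2 : j < i + n) : v i ≠ v j := by
  have key : ∀ i j, i < j → j < i + n → v i ≠ v j := by
    intro i j h1 h2
    by_cases h3 : j = i + 1
    · subst h3
      exact (ori_ne (L.pos i (i + 1) (i + 2) (by omega) (by omega) (by omega)).ne').1
    · exact (ori_ne (L.pos i (i + 1) j (by omega) (by omega) (by omega)).ne').2.1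
  rcases lt_or_gt_of_ne h with h | h
  · exact key i j h h2
  · exact (key j i h h1).symm

/-- r blocks the edge from vertex i to vertex j. -/
def Blk (R : Finset Pt) (v : ℕ → Pt) (i j : ℕ) (r : Pt) : Prop := r ∈ R ∧ Out (v i) (v j) r

theorem Blk.symm {R : Finset Pt} {v : ℕ → Pt} {i j : ℕ} {r : Pt} (h : Blk R v i j r) :
    Blk R v j i r := ⟨h.1, h.2.symm⟩

namespace Cfg
variable {n : ℕ} {P R : Finset Pt} {rr : Pt → Pt → Pt} {v : ℕ → Pt}

theorem blk_share (C : Cfg n P R rr) (L : Lab n P v) {a b c : ℕ} {r : Pt} (h1 : Blk R v a b r)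
    (h2 : Blk R v a c r) (hab : v a ≠ v b) (hac : v a ≠ v c) (hbc : v b ≠ v c) : False :=
  C.share (L.mem a) (L.mem b) (L.mem c) hab hac hbc h1.2 h2.2 h1.1

theorem blk_cross (L : Lab n P v) {i k m l : ℕ} {r : Pt} (h1 : Blk R v i m r)
    (h2 : Blk R v k l r) (hik : i < k) (hkm : k < m) (hml : m < l) (hl : l < i + n) : False := by
  refine ns2 h1.2 h2.2 (mul_neg_of_neg_of_pos ?_ ?_)
  · have := L.pos i k m hik hkm (by omega)
    rw [ori_sw]; linarith
  · exact L.pos i m l (by omega) hml hl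

/-- The thrackle argument. -/
theorem step (C : Cfg n P R rr) (L : Lab n P v) {i j : ℕ} (hij : i + 1 < j) (hj : j + 1 < i + n)
    {r r' : Pt} (h1 : Blk R v (i + 1) j r) (h2 : Blk R v i (j + 1) r') :
    r' = r ∧ ∀ q ∈ R, q = r ∨ ∃ a b, i < a ∧ a < b ∧ b < a + n ∧ q = rr (v a) (v b) := by
  have hn : 3 ≤ n := by omega
  have blk : ∀ a b, a < b → b < a + n → Blk R v a b (rr (v a) (v b)) := by
    intro a b h1 h2
    have := L.ne hn h1.ne (by omega) h2
    exact ⟨C.mem _ (L.mem a) _ (L.mem b) this, C.out _ (L.mem a) _ (L.mem b) this⟩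
  have bper : ∀ a b r, Blk R v a (b + n) r → Blk R v a b r := by
    intro a b r h; unfold Blk at *; rwa [L.per] at h
  set T : ℕ → Pt := fun m => if j < m then rr (v (i + 1)) (v m) else rr (v m) (v (i + n)) with hT
  have T1 : ∀ m, j < m → m ≤ i + n → Blk R v (i + 1) m (T m) := by
    intro m h1 h2; simp only [hT, if_pos h1]; exact blk _ _ (by omega) (by omega)
  have T2 : ∀ m, ¬ j < m → i + 1 < m → Blk R v m (i + n) (T m) := by
    intro m h1 h2; simp only [hT, if_neg h1]; exact blk _ _ (by omega) (by omega)
  have Tlt : ∀ m m', i + 1 < m → m < m' → m' ≤ i + n → T m ≠ T m' := by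
    intro m m' a1 a2 a3 he
    by_cases b1 : j < m
    · have e1 := T1 m b1 (by omega)
      have e2 := T1 m' (by omega) a3
      rw [← he] at e2
      exact C.blk_share L e1 e2 (L.ne hn (by omega) (by omega) (by omega))
        (L.ne hn (by omega) (by omega) (by omega)) (L.ne hn (by omega) (by omega) (by omega))
    · have e1 := T2 m b1 (by omega)
      by_cases b2 : j < m'
      · have e2 := T1 m' b2 a3
        rw [← he] at e2
        by_cases b3 : m' = i + n
        · subst b3
          exact C.blk_share L e1.symm e2.symm (L.ne hn (by omega) (by omega) (by omega))
            (L.ne hn (by omega) (by omega) (by omega)) (L.ne hn (by omega) (by omega) (by omega))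
        · exact blk_cross L e2 e1 (by omega) (by omega) (by omega) (by omega)
      · have e2 := T2 m' b2 (by omega)
        rw [← he] at e2
        exact C.blk_share L e1.symm e2.symm (L.ne hn (by omega) (by omega) (by omega))
            (L.ne hn (by omega) (by omega) (by omega)) (L.ne hn (by omega) (by omega) (by omega))
  have Tinj : Set.InjOn T (Finset.Icc (i + 2) (i + n) : Finset ℕ) := by
    intro m hm m' hm' he
    simp only [Finset.coe_Icc, Set.mem_Icc] at hm hm'
    by_contra hne
    rcases lt_or_gt_of_ne hne with h | h
    · exact Tlt m m' (by omega) h hm'.2 he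
    · exact Tlt m' m (by omega) h hm.2 he.symm
  have TR : (Finset.Icc (i + 2) (i + n)).image T ⊆ R := by
    intro q hq
    rw [Finset.mem_image] at hq
    obtain ⟨m, hm, rfl⟩ := hq
    rw [Finset.mem_Icc] at hm
    by_cases b : j < m
    · exact (T1 m b hm.2).1
    · exact (T2 m b (by omega)).1
  have hr : r ∉ (Finset.Icc (i + 2) (i + n)).image T := by
    intro hq
    rw [Finset.mem_image] at hq
    obtain ⟨m, hm, he⟩ := hq
    rw [Finset.mem_Icc] at hm
    by_cases b : j < m
    · have e1 := T1 m b hm.2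
      rw [he] at e1
      exact C.blk_share L e1 h1 (L.ne hn (by omega) (by omega) (by omega))
        (L.ne hn (by omega) (by omega) (by omega)) (L.ne hn (by omega) (by omega) (by omega))
    · have e1 := T2 m b (by omega)
      rw [he] at e1
      by_cases b3 : m = j
      · subst b3
        exact C.blk_share L e1 h1.symm (L.ne hn (by omega) (by omega) (by omega))
          (L.ne hn (by omega) (by omega) (by omega)) (L.ne hn (by omega) (by omega) (by omega))
      · exact blk_cross L h1 e1 (by omega) (by omega) (by omega) (by omega)
  have hr' : r' ∉ (Finset.Icc (i + 2) (i + n)).image T := by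
    intro hq
    rw [Finset.mem_image] at hq
    obtain ⟨m, hm, he⟩ := hq
    rw [Finset.mem_Icc] at hm
    by_cases b : j < m
    · have e1 := T1 m b hm.2
      rw [he] at e1
      by_cases b3 : m = j + 1
      · subst b3
        exact C.blk_share L e1.symm h2.symm (L.ne hn (by omega) (by omega) (by omega))
          (L.ne hn (by omega) (by omega) (by omega)) (L.ne hn (by omega) (by omega) (by omega))
      by_cases b4 : m = i + n
      · subst b4
        exact C.blk_share L (bper _ _ _ e1).symm h2 (L.ne hn (by omega) (by omega) (by omega))
          (L.ne hn (by omega) (by omega) (by omega)) (L.ne hn (by omega) (by omega) (by omega))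
      · exact blk_cross L h2 e1 (by omega) (by omega) (by omega) (by omega)
    · have e1 := T2 m b (by omega)
      rw [he] at e1
      exact C.blk_share L (bper _ _ _ e1).symm h2 (L.ne hn (by omega) (by omega) (by omega))
        (L.ne hn (by omega) (by omega) (by omega)) (L.ne hn (by omega) (by omega) (by omega))
  have hins : insert r ((Finset.Icc (i + 2) (i + n)).image T) = R := by
    apply Finset.eq_of_subset_of_card_le
    · exact Finset.insert_subset h1.1 TR
    · rw [Finset.card_insert_of_notMem hr, Finset.card_image_of_injOn Tinj, Nat.card_Icc, C.cR]
      omega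
  refine ⟨?_, ?_⟩
  · have := h2.1
    rw [← hins, Finset.mem_insert] at this
    rcases this with h | h
    · exact h
    · exact absurd h hr'
  · intro q hq
    rw [← hins, Finset.mem_insert, Finset.mem_image] at hq
    rcases hq with h | ⟨m, hm, rfl⟩
    · exact Or.inl h
    rw [Finset.mem_Icc] at hm
    right
    by_cases b : j < m
    · exact ⟨i + 1, m, by omega, by omega, by omega, by simp [hT, b]⟩
    · exact ⟨m, i + n, by omega, by omega, by omega, by simp [hT, b]⟩

theorem exists_rho (C : Cfg n P R rr) (L : Lab n P v) (hn : 5 ≤ n) : ∃ ρ : ℕ → Pt,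
    (∀ i j, i < j → j < i + n → ρ (i + j) ∈ R ∧ ori (v i) (v j) (ρ (i + j)) = 0) ∧
    ∀ q ∈ R, ∀ N, ∃ i j, N ≤ i ∧ i < j ∧ j < i + n ∧ q = ρ (i + j) := by
  have blk : ∀ a b, a < b → b < a + n → Blk R v a b (rr (v a) (v b)) := by
    intro a b h1 h2
    have := L.ne (by omega) h1.ne (by omega) h2
    exact ⟨C.mem _ (L.mem a) _ (L.mem b) this, C.out _ (L.mem a) _ (L.mem b) this⟩
  have key : ∀ d i j, j = i + d → 0 < d → d < n → rr (v i) (v j) =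
      rr (v ((i + j - 1) / 2)) (v ((i + j) / 2 + 1)) := by
    intro d
    induction d using Nat.strong_induction_on with
    | _ d ih =>
      intro i j hj h0 hd
      by_cases h : d ≤ 2
      · have e1 : (i + j - 1) / 2 = i := by omega
        have e2 : (i + j) / 2 + 1 = j := by omega
        rw [e1, e2]
      · obtain ⟨k, rfl⟩ : ∃ k, j = k + 1 := ⟨j - 1, by omega⟩
        have h1 := ih (d - 2) (by omega) (i + 1) k (by omega) (by omega) (by omega)
        have h2 := (C.step L (i := i) (j := k) (by omega) (by omega) (blk _ _ (by omega) (by omega))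
          (blk _ _ (by omega) (by omega))).1
        rw [h2, h1, show i + 1 + k = i + (k + 1) by omega]
  refine ⟨fun s => rr (v ((s - 1) / 2)) (v (s / 2 + 1)), ?_, ?_⟩
  · intro i j h1 h2
    have := key (j - i) i j (by omega) (by omega) (by omega)
    beta_reduce
    rw [← this]
    exact ⟨(blk i j h1 h2).1, (blk i j h1 h2).2.ori⟩
  · intro q hq N
    have h2 := (C.step L (i := N) (j := N + 2) (by omega) (by omega) (blk _ _ (by omega) (by omega))
          (blk _ _ (by omega) (by omega))).2 q hq
    rcases h2 with h | ⟨a, b, h1, h2, h3, h4⟩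
    · refine ⟨N + 1, N + 2, by omega, by omega, by omega, ?_⟩
      rw [h]
      exact key 1 _ _ (by omega) (by omega) (by omega)
    · refine ⟨a, b, by omega, h2, h3, ?_⟩
      rw [h4]
      exact key (b - a) _ _ (by omega) (by omega) (by omega)

end Cfg


theorem corner {p q s q' s' : Pt} (h : ori p q s ≠ 0) (hq : ori p q q' = 0) (hq' : q' ≠ p)
    (hs : ori p s s' = 0) (hs' : s' ≠ p) : ori p q' s' ≠ 0 := by
  obtain ⟨n1, n2, n3⟩ := ori_ne h
  obtain ⟨t, ht⟩ := param n1 hq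
  obtain ⟨u, hu⟩ := param n2 hs
  have e : ori p q' s' = t * u * ori p q s := by simp only [ori, ht, hu]; ring
  rw [e]
  have t0 : t ≠ 0 := by rintro rfl; apply hq'; funext i; rw [ht]; ring
  have u0 : u ≠ 0 := by rintro rfl; apply hs'; funext i; rw [hu]; ring
  exact mul_ne_zero (mul_ne_zero t0 u0) h

theorem ori_z1 {a b c : Pt} (h : ori a b c = 0) : ori b c a = 0 := by rw [← ori_rot]; exact h
theorem ori_z2 {a b c : Pt} (h : ori a b c = 0) : ori a c b = 0 := by
  rw [ori_sw, h, neg_zero]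
theorem ori_n1 {a b c : Pt} (h : ori a b c ≠ 0) : ori b c a ≠ 0 := by rw [← ori_rot]; exact h
theorem ori_n2 {a b c : Pt} (h : ori a b c ≠ 0) : ori a c b ≠ 0 := by
  rw [ori_sw]; exact neg_ne_zero.2 h

/-- Indexed point data. -/
structure Rho (n : ℕ) (P R : Finset Pt) (v ρ : ℕ → Pt) : Prop where
  gp : ∀ a b c, a ≠ b → a ≠ c → b ≠ c → a < b + n → b < a + n → a < c + n → c < a + n →
    b < c + n → c < b + n → ori (v a) (v b) (v c) ≠ 0
  nep : ∀ i j k, i ≠ j → i < j + n → j < i + n → ρ (i + j) ≠ v k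
  line : ∀ i j, i ≠ j → i < j + n → j < i + n → ori (v i) (v j) (ρ (i + j)) = 0

namespace Rho
variable {n : ℕ} {P R : Finset Pt} {v ρ : ℕ → Pt}

theorem gridA (H : Rho n P R v ρ) (c : Fin 10 → ℝ) (N x x' y y' z z' : ℕ)
    (hw : ∀ m ∈ [x, x', y, y', z, z'], N ≤ m ∧ m < N + n) (hd : [x, x', y, y', z, z'].Nodup)
    (s1 : x' + y = x + y') (s2 : y' + z = y + z') (s3 : x' + z = x + z')
    (e1 : cubv c (v x 0) (v x 1) = 0) (e2 : cubv c (v x' 0) (v x' 1) = 0)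
    (e3 : cubv c (v y 0) (v y 1) = 0) (e4 : cubv c (v y' 0) (v y' 1) = 0)
    (e5 : cubv c (v z 0) (v z 1) = 0) (e6 : cubv c (v z' 0) (v z' 1) = 0)
    (e7 : cubv c (ρ (x + y') 0) (ρ (x + y') 1) = 0)
    (e8 : cubv c (ρ (y + z') 0) (ρ (y + z') 1) = 0) :
    cubv c (ρ (x + z') 0) (ρ (x + z') 1) = 0 := by
  simp only [List.mem_cons, List.not_mem_nil, or_false, forall_eq_or_imp, forall_eq] at hw
  simp only [List.nodup_cons, List.mem_cons, List.not_mem_nil, or_false, not_or,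
    not_false_eq_true, List.nodup_nil, and_true] at hd
  obtain ⟨w1, w2, w3, w4, w5, w6⟩ := hw
  obtain ⟨⟨d1, d2, d3, d4, d5⟩, ⟨d6, d7, d8, d9⟩, ⟨d10, d11, d12⟩, ⟨d13, d14⟩, d15⟩ := hd
  have xy1 := H.line x y' (by omega) (by omega) (by omega)
  have xy2 := H.line x' y (by omega) (by omega) (by omega)
  have yz1 := H.line y z' (by omega) (by omega) (by omega)
  have yz2 := H.line y' z (by omega) (by omega) (by omega)
  have xz1 := H.line x z' (by omega) (by omega) (by omega)
  have xz2 := H.line x' z (by omega) (by omega) (by omega)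
  have nxy := fun k => H.nep x y' k (by omega) (by omega) (by omega)
  have nyz := fun k => H.nep y z' k (by omega) (by omega) (by omega)
  have nxz := fun k => H.nep x z' k (by omega) (by omega) (by omega)
  rw [s1] at xy2
  rw [s2] at yz2
  rw [s3] at xz2
  generalize ρ (x + y') = a at *
  generalize ρ (y + z') = b at *
  generalize ρ (x + z') = d at *
  have g1 := H.gp y x' z' (by omega) (by omega) (by omega) (by omega) (by omega) (by omega) (by omega) (by omega) (by omega)
  have g2 := H.gp y x' y' (by omega) (by omega) (by omega) (by omega) (by omega) (by omega) (by omega) (by omega) (by omega)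
  have g3 := H.gp y x' z (by omega) (by omega) (by omega) (by omega) (by omega) (by omega) (by omega) (by omega) (by omega)
  have g4 := H.gp x' z y (by omega) (by omega) (by omega) (by omega) (by omega) (by omega) (by omega) (by omega) (by omega)
  have g5 := H.gp y x' x (by omega) (by omega) (by omega) (by omega) (by omega) (by omega) (by omega) (by omega) (by omega)
  have g6 := H.gp y' z' z (by omega) (by omega) (by omega) (by omega) (by omega) (by omega) (by omega) (by omega) (by omega)
  have g7 := H.gp y' x z (by omega) (by omega) (by omega) (by omega) (by omega) (by omega) (by omega) (by omega) (by omega)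
  have g8 := H.gp z' x y (by omega) (by omega) (by omega) (by omega) (by omega) (by omega) (by omega) (by omega) (by omega)
  have xy2' : ori (v y) (v x') a = 0 := by rw [ori_sw1, xy2, neg_zero]
  have k1 := corner g1 xy2' (nxy _) yz1 (nyz _)
  have k2 := corner g2 xy2' (nxy _) (ori_self3 _ _) (ori_ne g2).2.1.symm
  have k3 := corner g3 xy2' (nxy _) (ori_self3 _ _) (ori_ne g3).2.1.symm
  have q1 := corner g1 xy2' (nxy _) (ori_self3 _ _) (ori_ne g1).2.1.symm
  have q2 := corner g5 xy2' (nxy _) (ori_self3 _ _) (ori_ne g5).2.1.symm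
  have q3 := corner g6 (ori_self3 _ _) (ori_ne g6).1.symm yz2 (nyz _)
  have q4 := corner g7 (ori_self3 _ _) (ori_ne g7).1.symm yz2 (nyz _)
  exact grid c (v y) a (v x') b (v y') (v z) (v z') (v x) d
    (ori_z2 xy2') (ori_z1 (ori_z1 yz2)) (by rw [ori_sw1, xz1, neg_zero]) xz2
    (nxy _).symm (ori_ne g1).1 (nxy _) k1 k2 k3 (ori_n1 k2) g4
    (nyz _) (nyz _) (ori_ne g6).2.1 q1 q2 (ori_n1 (ori_n1 q3)) (ori_n1 (ori_n1 q4)) (ori_ne g8).1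
    e3 e7 e2 e8 e4 e5 e6 e1 (ori_z2 yz1) (ori_z2 (ori_z1 (ori_z1 xy1)))

theorem gridB (H : Rho n P R v ρ) (c : Fin 10 → ℝ) (N x x' y y' z z' : ℕ)
    (hw : ∀ m ∈ [x, x', y, y', z, z'], N ≤ m ∧ m < N + n) (hd : [x, x', y, y', z, z'].Nodup)
    (s1 : x' + y = x + y') (s2 : y' + z = y + z') (s3 : x' + z = x + z')
    (e1 : cubv c (v x 0) (v x 1) = 0) (e2 : cubv c (v x' 0) (v x' 1) = 0)
    (e3 : cubv c (v y 0) (v y 1) = 0) (e4 : cubv c (v y' 0) (v y' 1) = 0)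
    (e5 : cubv c (v z 0) (v z 1) = 0)
    (e7 : cubv c (ρ (x + y') 0) (ρ (x + y') 1) = 0)
    (e8 : cubv c (ρ (y' + z) 0) (ρ (y' + z) 1) = 0)
    (e9 : cubv c (ρ (x' + z) 0) (ρ (x' + z) 1) = 0) :
    cubv c (v z' 0) (v z' 1) = 0 := by
  simp only [List.mem_cons, List.not_mem_nil, or_false, forall_eq_or_imp, forall_eq] at hw
  simp only [List.nodup_cons, List.mem_cons, List.not_mem_nil, or_false, not_or,
    not_false_eq_true, List.nodup_nil, and_true] at hd
  obtain ⟨w1, w2, w3, w4, w5, w6⟩ := hw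
  obtain ⟨⟨d1, d2, d3, d4, d5⟩, ⟨d6, d7, d8, d9⟩, ⟨d10, d11, d12⟩, ⟨d13, d14⟩, d15⟩ := hd
  have xy1 := H.line x y' (by omega) (by omega) (by omega)
  have xy2 := H.line x' y (by omega) (by omega) (by omega)
  have yz1 := H.line y z' (by omega) (by omega) (by omega)
  have yz2 := H.line y' z (by omega) (by omega) (by omega)
  have xz1 := H.line x z' (by omega) (by omega) (by omega)
  have xz2 := H.line x' z (by omega) (by omega) (by omega)
  have nxy := fun k => H.nep x y' k (by omega) (by omega) (by omega)
  have nyz := fun k => H.nep y z' k (by omega) (by omega) (by omega)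
  have nxz := fun k => H.nep x z' k (by omega) (by omega) (by omega)
  rw [s1] at xy2
  rw [s2] at yz2 e8
  rw [s3] at xz2 e9
  generalize ρ (x + y') = a at *
  generalize ρ (y + z') = b at *
  generalize ρ (x + z') = d at *
  have g1 := H.gp x' y z (by omega) (by omega) (by omega) (by omega) (by omega) (by omega) (by omega) (by omega) (by omega)
  have g2 := H.gp x' y y' (by omega) (by omega) (by omega) (by omega) (by omega) (by omega) (by omega) (by omega) (by omega)
  have g3 := H.gp y z' x' (by omega) (by omega) (by omega) (by omega) (by omega) (by omega) (by omega) (by omega) (by omega)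
  have g4 := H.gp x' y x (by omega) (by omega) (by omega) (by omega) (by omega) (by omega) (by omega) (by omega) (by omega)
  have g5 := H.gp z y' x' (by omega) (by omega) (by omega) (by omega) (by omega) (by omega) (by omega) (by omega) (by omega)
  have g6 := H.gp z y' x (by omega) (by omega) (by omega) (by omega) (by omega) (by omega) (by omega) (by omega) (by omega)
  have xz2' : ori (v z) (v x') d = 0 := by rw [ori_sw1, xz2, neg_zero]
  have k1 := corner g1 xy2 (nxy _) (ori_self3 _ _) (ori_ne g1).2.1.symm
  have k2 := corner g2 xy2 (nxy _) (ori_self3 _ _) (ori_ne g2).2.1.symm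
  have m3 := corner g3 yz1 (nyz _) (ori_self3 _ _) (ori_ne g3).2.1.symm
  have k3 := corner (ori_n1 (ori_n1 m3)) xy2 (nxy _) (ori_self3 _ _) (nyz _)
  have q1 := corner g1 xy2 (nxy _) xz2 (nxz _)
  have q2 := corner g4 xy2 (nxy _) (ori_self3 _ _) (ori_ne g4).2.1.symm
  have q3 := corner g5 (ori_self3 _ _) (ori_ne g5).1.symm xz2' (nxz _)
  exact grid c (v x') a (v y) (v z) (v y') b d (v x) (v z')
    (ori_z2 xy2) (by rw [ori_sw1, yz2, neg_zero]) (ori_z1 (ori_z1 xz1)) (ori_z2 yz1)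
    (nxy _).symm (ori_ne g1).1 (nxy _) k1 k2 k3 (ori_n1 k2) m3
    (ori_ne g6).1 (nyz _).symm (nyz _).symm q1 q2 q3 g6 (nxz _)
    e2 e7 e3 e5 e4 e8 e9 e1 xz2 (ori_z2 (ori_z1 (ori_z1 xy1)))

theorem run6 (H : Rho n P R v ρ) (hper : ∀ k, v (k + n) = v k) (hn : 6 ≤ n) (c : Fin 10 → ℝ)
    (h0 : ∀ k, k < 6 → cubv c (v k 0) (v k 1) = 0)
    (h3 : ∀ k, 3 ≤ k → k < 6 → cubv c (ρ k 0) (ρ k 1) = 0) :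
    ∀ i, (∀ k, i ≤ k → k < i + 6 → cubv c (v k 0) (v k 1) = 0) ∧
      (∀ k, 2 * i + 3 ≤ k → k < 2 * i + 6 → cubv c (ρ k 0) (ρ k 1) = 0) := by
  intro i
  induction i with
  | zero => exact ⟨fun k _ h => h0 k (by omega), fun k h h' => h3 k (by omega) (by omega)⟩
  | succ i ih =>
    obtain ⟨hv, hr⟩ := ih
    have r7 : cubv c (ρ (2 * i + 7) 0) (ρ (2 * i + 7) 1) = 0 := by
      have := H.gridA c i (i + 2) (i + 3) (i + 0) (i + 1) (i + 4) (i + 5) (by simp; omega) (by simp)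
        (by omega) (by omega) (by omega) (hv _ (by omega) (by omega)) (hv _ (by omega) (by omega))
        (hv _ (by omega) (by omega)) (hv _ (by omega) (by omega)) (hv _ (by omega) (by omega))
        (hv _ (by omega) (by omega)) (hr _ (by omega) (by omega)) (hr _ (by omega) (by omega))
      rwa [show i + 2 + (i + 5) = 2 * i + 7 by omega] at this
    have r6 : cubv c (ρ (2 * i + 6) 0) (ρ (2 * i + 6) 1) = 0 := by
      have := H.gridA c i (i + 1) (i + 4) (i + 0) (i + 3) (i + 2) (i + 5) (by simp; omega) (by simp)
        (by omega) (by omega) (by omega) (hv _ (by omega) (by omega)) (hv _ (by omega) (by omega))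
        (hv _ (by omega) (by omega)) (hv _ (by omega) (by omega)) (hv _ (by omega) (by omega))
        (hv _ (by omega) (by omega)) (hr _ (by omega) (by omega)) (hr _ (by omega) (by omega))
      rwa [show i + 1 + (i + 5) = 2 * i + 6 by omega] at this
    have a6 : cubv c (v (i + 6) 0) (v (i + 6) 1) = 0 := by
      by_cases hn6 : n = 6
      · subst hn6
        rw [hper]; exact hv _ (by omega) (by omega)
      refine H.gridB c i (i + 0) (i + 2) (i + 1) (i + 3) (i + 4) (i + 6) (by simp; omega) (by simp)
        (by omega) (by omega) (by omega) (hv _ (by omega) (by omega)) (hv _ (by omega) (by omega))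
        (hv _ (by omega) (by omega)) (hv _ (by omega) (by omega)) (hv _ (by omega) (by omega))
        (hr _ (by omega) (by omega)) ?_ ?_
      · rwa [show i + 3 + (i + 4) = 2 * i + 7 by omega]
      · rwa [show i + 2 + (i + 4) = 2 * i + 6 by omega]
    refine ⟨fun k h1 h2 => ?_, fun k h1 h2 => ?_⟩
    · by_cases h : k = i + 6
      · rw [h]; exact a6
      · exact hv k (by omega) (by omega)
    · by_cases h : k = 2 * i + 7
      · rw [h]; exact r7
      by_cases h' : k = 2 * i + 6
      · rw [h']; exact r6
      · exact hr k (by omega) (by omega)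

end Rho


namespace Cfg
variable {n : ℕ} {P R : Finset Pt} {rr : Pt → Pt → Pt} {v : ℕ → Pt}

theorem big (C : Cfg n P R rr) (L : Lab n P v) (hn : 6 ≤ n) :
    ∃ c : Fin 10 → ℝ, c ≠ 0 ∧ ∀ p ∈ P ∪ R, cubv c (p 0) (p 1) = 0 := by
  obtain ⟨ρ, h1, h2⟩ := C.exists_rho L (by omega)
  have key : ∀ i j, i ≠ j → i < j + n → j < i + n →
      ρ (i + j) ∈ R ∧ ori (v i) (v j) (ρ (i + j)) = 0 := by
    intro i j a1 a2 a3
    rcases lt_or_gt_of_ne a1 with h | h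
    · exact h1 i j h a3
    · have := h1 j i h a2
      rw [Nat.add_comm] at this
      exact ⟨this.1, by rw [ori_sw1, this.2, neg_zero]⟩
  have H : Rho n P R v ρ := by
    refine ⟨?_, ?_, ?_⟩
    · intro a b c x1 x2 x3 x4 x5 x6 x7 x8 x9
      exact C.gp _ (L.mem a) _ (L.mem b) _ (L.mem c) (L.ne (by omega) x1 x4 x5)
        (L.ne (by omega) x2 x6 x7) (L.ne (by omega) x3 x8 x9)
    · intro i j k x1 x2 x3 he
      have := (key i j x1 x2 x3).1
      rw [he] at this
      exact C.dj _ (L.mem k) this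
    · intro i j x1 x2 x3
      exact (key i j x1 x2 x3).2
  obtain ⟨c, c0, hc⟩ := exists_cub9 ![v 0, v 1, v 2, v 3, v 4, v 5, ρ 3, ρ 4, ρ 5]
  refine ⟨c, c0, ?_⟩
  have R6 := H.run6 L.per hn c (by
      intro k hk
      interval_cases k
      · exact hc 0
      · exact hc 1
      · exact hc 2
      · exact hc 3
      · exact hc 4
      · exact hc 5) (by
      intro k hk hk'
      interval_cases k
      · exact hc 6
      · exact hc 7
      · exact hc 8)
  intro p hp
  rw [Finset.mem_union] at hp
  rcases hp with hp | hp
  · obtain ⟨i, hi, rfl⟩ := L.surj p hp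
    exact (R6 i).1 i (by omega) (by omega)
  · obtain ⟨i, j, hi, hij, hj, rfl⟩ := h2 p hp 3
    exact (R6 ((i + j - 3) / 2)).2 (i + j) (by omega) (by omega)

theorem five (C : Cfg 5 P R rr) (L : Lab 5 P v) :
    ∃ c : Fin 10 → ℝ, c ≠ 0 ∧ ∀ p ∈ P ∪ R, cubv c (p 0) (p 1) = 0 := by
  obtain ⟨ρ, h1, h2⟩ := C.exists_rho L le_rfl
  have pp := L.pos
  obtain ⟨c, c0, e0, e1, e2, e3, e4, t1, t2, t3, t4, t5⟩ := pent (v 0) (v 1) (v 2) (v 3) (v 4)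
    (pp _ _ _ (by omega) (by omega) (by omega)) (pp _ _ _ (by omega) (by omega) (by omega))
    (pp _ _ _ (by omega) (by omega) (by omega)) (pp _ _ _ (by omega) (by omega) (by omega))
    (pp _ _ _ (by omega) (by omega) (by omega)) (pp _ _ _ (by omega) (by omega) (by omega))
    (pp _ _ _ (by omega) (by omega) (by omega))
  refine ⟨c, c0, ?_⟩
  have sy : ∀ {a b r : Pt}, ori a b r = 0 → ori b a r = 0 := by
    intro a b r h; rw [ori_sw1, h, neg_zero]
  have vm : ∀ q r, v (5 * q + r) = v r := by
    intro q r
    induction q with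
    | zero => simp
    | succ q ih => rw [← ih, show 5 * (q + 1) + r = 5 * q + r + 5 by omega, L.per]
  intro p hp
  rw [Finset.mem_union] at hp
  rcases hp with hp | hp
  · obtain ⟨i, hi, rfl⟩ := L.surj p hp
    interval_cases i <;> assumption
  obtain ⟨i, j, hi, hij, hj, rfl⟩ := h2 p hp 10
  have two : ∀ a b a' b' q q2 q3 q4 w x y z, a + b = i + j → a' + b' = i + j → a < b → b < a + 5 →
      a' < b' → b' < a' + 5 → a = 5 * q + w → b = 5 * q2 + x → a' = 5 * q3 + y → b' = 5 * q4 + z →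
      ori (v w) (v x) (ρ (i + j)) = 0 ∧ ori (v y) (v z) (ρ (i + j)) = 0 := by
    intro a b a' b' q q2 q3 q4 w x y z s1 s2 o1 o2 o3 o4 f1 f2 f3 f4
    have g1 := (h1 a b o1 o2).2
    have g2 := (h1 a' b' o3 o4).2
    rw [s1, f1, f2, vm, vm] at g1
    rw [s2, f3, f4, vm, vm] at g2
    exact ⟨g1, g2⟩
  generalize hs : i + j = s at *
  obtain ⟨m, hm⟩ : ∃ m, s = 10 * m + 10 + s % 10 := ⟨s / 10 - 1, by omega⟩
  have hlt : s % 10 < 10 := Nat.mod_lt _ (by omega)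
  generalize s % 10 = w at *
  interval_cases w
  ·
    obtain ⟨g1, g2⟩ := two (5*m+4) (5*m+6) (5*m+3) (5*m+7) m (m+1) m (m+1) 4 1 3 2 (by omega)
      (by omega) (by omega) (by omega) (by omega) (by omega) (by omega) (by omega) (by omega) (by omega)
    exact t4 _ (sy g1) (sy g2)
  · obtain ⟨g1, g2⟩ := two (5*m+5) (5*m+6) (5*m+4) (5*m+7) (m+1) (m+1) m (m+1) 0 1 4 2 (by omega)
      (by omega) (by omega) (by omega) (by omega) (by omega) (by omega) (by omega) (by omega) (by omega)
    exact t1 _ g1 (sy g2)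
  · obtain ⟨g1, g2⟩ := two (5*m+5) (5*m+7) (5*m+4) (5*m+8) (m+1) (m+1) m (m+1) 0 2 4 3 (by omega)
      (by omega) (by omega) (by omega) (by omega) (by omega) (by omega) (by omega) (by omega) (by omega)
    exact t3 _ g1 (sy g2)
  · obtain ⟨g1, g2⟩ := two (5*m+6) (5*m+7) (5*m+5) (5*m+8) (m+1) (m+1) (m+1) (m+1) 1 2 0 3 (by omega)
      (by omega) (by omega) (by omega) (by omega) (by omega) (by omega) (by omega) (by omega) (by omega)
    exact t2 _ g1 g2
  · obtain ⟨g1, g2⟩ := two (5*m+5) (5*m+9) (5*m+6) (5*m+8) (m+1) (m+1) (m+1) (m+1) 0 4 1 3 (by omega)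
      (by omega) (by omega) (by omega) (by omega) (by omega) (by omega) (by omega) (by omega) (by omega)
    exact t5 _ g1 g2
  · obtain ⟨g1, g2⟩ := two (5*m+6) (5*m+9) (5*m+7) (5*m+8) (m+1) (m+1) (m+1) (m+1) 1 4 2 3 (by omega)
      (by omega) (by omega) (by omega) (by omega) (by omega) (by omega) (by omega) (by omega) (by omega)
    exact t4 _ g1 g2
  · obtain ⟨g1, g2⟩ := two (5*m+6) (5*m+10) (5*m+7) (5*m+9) (m+1) (m+2) (m+1) (m+1) 1 0 2 4 (by omega)
      (by omega) (by omega) (by omega) (by omega) (by omega) (by omega) (by omega) (by omega) (by omega)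
    exact t1 _ (sy g1) g2
  · obtain ⟨g1, g2⟩ := two (5*m+7) (5*m+10) (5*m+8) (5*m+9) (m+1) (m+2) (m+1) (m+1) 2 0 3 4 (by omega)
      (by omega) (by omega) (by omega) (by omega) (by omega) (by omega) (by omega) (by omega) (by omega)
    exact t3 _ (sy g1) g2
  · obtain ⟨g1, g2⟩ := two (5*m+7) (5*m+11) (5*m+8) (5*m+10) (m+1) (m+2) (m+1) (m+2) 2 1 3 0 (by omega)
      (by omega) (by omega) (by omega) (by omega) (by omega) (by omega) (by omega) (by omega) (by omega)
    exact t2 _ (sy g1) (sy g2)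
  · obtain ⟨g1, g2⟩ := two (5*m+9) (5*m+10) (5*m+8) (5*m+11) (m+1) (m+2) (m+1) (m+2) 4 0 3 1 (by omega)
      (by omega) (by omega) (by omega) (by omega) (by omega) (by omega) (by omega) (by omega) (by omega)
    exact t5 _ (sy g1) (sy g2)

end Cfg

theorem stmt11 (n : ℕ) (P R : Finset Pt) (hPcard : P.card = n) (hRcard : R.card = n)
    (hgp : GenPos ↑P) (hdisj : Disjoint P R)
    (hpierce : ∀ x ∈ P, ∀ y ∈ P, x ≠ y →
      ∃ r ∈ R, Collinear ℝ ({x, y, r} : Set Pt) ∧ r ∉ segment ℝ x y) :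
    ∃ f : MvPolynomial (Fin 2) ℝ, f ≠ 0 ∧ f.totalDegree ≤ 3 ∧
      ∀ p ∈ P ∪ R, MvPolynomial.eval p f = 0 := by
  obtain ⟨c, c0, hc⟩ : ∃ c : Fin 10 → ℝ, c ≠ 0 ∧ ∀ p ∈ P ∪ R, cubv c (p 0) (p 1) = 0 := by
    by_cases h4 : n ≤ 4
    · refine exists_cub_finset _ ((Finset.card_union_le _ _).trans ?_)
      omega
    obtain ⟨rr, C⟩ := exists_cfg n P R hPcard hRcard hgp hdisj hpierce
    obtain ⟨v, L⟩ := C.exists_lab (by omega)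
    by_cases h5 : n = 5
    · subst h5
      exact C.five L
    · exact C.big L (by omega)
  obtain ⟨f, f0, fd, hf⟩ := to_mv c c0
  exact ⟨f, f0, fd, fun p hp => by rw [hf]; exact hc p hp⟩
end
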